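/- There exist a bounded linear operator T and a unitary operator V on a complex separable infinite-dimensional Hilbert space H such that: (i) for every non-zero vector x of H, either x or Vx is hypercyclic for T; and (ii) the closure, in the operator-norm topology of B(H), of the subalgebra of B(H) generated by T and V^{-1} T V contains every compact operator on H. -/

import Mathlib

set_option linter.unusedSectionVars false

section
open Filter Topology InnerProductSpace

theorem aux_rec {α : Type*} (i : ℕ → ℕ) (hi : ∀ k, 1 ≤ k → i k < k) (a0 : α) (F : ℕ → α → α) :
    ∃ g : ℕ → α, g 0 = a0 ∧ ∀ k, 1 ≤ k → g k = F k (g (i k)) := by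
  let G : (n : ℕ) → ((m : ℕ) → m < n → α) → α := fun n rec =>
    if h : 1 ≤ n then F n (rec (i n) (hi n h)) else a0
  refine ⟨fun n => WellFounded.fix (C := fun _ => α) Nat.lt_wfRel.wf G n, ?_, ?_⟩
  · show WellFounded.fix (C := fun _ => α) Nat.lt_wfRel.wf G 0 = a0
    rw [WellFounded.fix_eq]; simp [G]
  · intro k hk
    show WellFounded.fix (C := fun _ => α) Nat.lt_wfRel.wf G k = _
    rw [WellFounded.fix_eq]; simp [G, hk]

theorem aux_basis (H : Type) [NormedAddCommGroup H] [InnerProductSpace ℂ H] [CompleteSpace H]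
    [TopologicalSpace.SeparableSpace H] (hdim : ¬ FiniteDimensional ℂ H) :
    Nonempty (HilbertBasis ℕ ℂ H) := by
  obtain ⟨w, b, hb⟩ := exists_hilbertBasis ℂ H
  have ho := b.orthonormal
  have hc : w.Countable := by
    have : Countable w := by
      apply Pairwise.countable_of_isOpen_disjoint (s := fun x : w => Metric.ball (x : H) (1/2))
      · intro x y hxy
        apply Metric.ball_disjoint_ball
        have h2 : ‖(x:H) - y‖ * ‖(x:H) - y‖ = 2 := by
          have := norm_sub_mul_self (𝕜 := ℂ) (x:H) y
          have hx := ho.1 x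
          have hy := ho.1 y
          have hxy' := ho.2 hxy
          rw [hb] at hx hy hxy'
          rw [this, hx, hy, hxy']; norm_num
        rw [dist_eq_norm]
        nlinarith [norm_nonneg ((x:H) - y)]
      · intro x; exact Metric.isOpen_ball
      · intro x; exact ⟨x, Metric.mem_ball_self (by norm_num)⟩
    exact Set.countable_coe_iff.mp this
  have hinf : w.Infinite := by
    intro hf
    apply hdim
    have : Fintype w := hf.fintype
    have h1 := b.dense_span
    rw [Submodule.topologicalClosure_eq_top_iff] at h1
    have : FiniteDimensional ℂ (Submodule.span ℂ (Set.range b)) :=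
      FiniteDimensional.span_of_finite ℂ (Set.finite_range b)
    have h2 := (Submodule.span ℂ (Set.range b)).closed_of_finiteDimensional
    have h3 := b.dense_span
    rw [h2.submodule_topologicalClosure_eq] at h3
    rw [h3] at this
    exact Module.Finite.equiv (Submodule.topEquiv (R := ℂ) (M := H))
  have : Countable w := hc.to_subtype
  have : Infinite w := hinf.to_subtype
  obtain ⟨e⟩ : Nonempty (ℕ ≃ w) := by
    obtain ⟨hden⟩ := nonempty_denumerable w
    exact ⟨(Denumerable.eqv w).symm⟩
  refine ⟨HilbertBasis.mk (v := fun n => b (e n)) (ho.comp e e.injective) ?_⟩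
  have : Set.range (fun n => b (e n)) = Set.range b := e.surjective.range_comp b
  rw [this, b.dense_span]

section
variable {H : Type} [NormedAddCommGroup H] [InnerProductSpace ℂ H] [CompleteSpace H]

theorem aux_perm (b : HilbertBasis ℕ ℂ H) (σ : Equiv.Perm ℕ) (ρ : ℕ → ℂ) (hρ : ∀ k, ‖ρ k‖ = 1) :
    ∃ B : H ≃ₗᵢ[ℂ] H, ∀ k, B (b k) = ρ k • b (σ k) := by
  have ho : Orthonormal ℂ (fun k => ρ k • b (σ k)) := by
    have h0 := b.orthonormal
    constructor
    · intro k; simp [norm_smul, hρ, h0.1]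
    · intro k l hkl
      have := h0.2 (σ.injective.ne hkl)
      simp only [inner_smul_left, inner_smul_right]
      simp only at this
      rw [this]; simp
  have hs : ⊤ ≤ (Submodule.span ℂ (Set.range (fun k => ρ k • b (σ k)))).topologicalClosure := by
    rw [← b.dense_span]
    apply Submodule.topologicalClosure_mono
    rw [Submodule.span_le]
    rintro _ ⟨k, rfl⟩
    have h : b k = (ρ (σ.symm k))⁻¹ • (ρ (σ.symm k) • b (σ (σ.symm k))) := by
      have : ρ (σ.symm k) ≠ 0 := by
        intro h; have := hρ (σ.symm k); rw [h] at this; simp at this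
      rw [smul_smul, inv_mul_cancel₀ this]; simp
    rw [h]
    exact Submodule.smul_mem _ _ (Submodule.subset_span ⟨σ.symm k, rfl⟩)
  let b' := HilbertBasis.mk ho hs
  refine ⟨b.repr.trans b'.repr.symm, fun k => ?_⟩
  simp only [LinearIsometryEquiv.trans_apply, HilbertBasis.repr_self, HilbertBasis.repr_symm_single]
  simp [b']

theorem aux_coord (b : HilbertBasis ℕ ℂ H) (x : H) :
    HasSum (fun k => inner ℂ (b k) x • b k) x := by
  simpa [HilbertBasis.repr_apply_apply] using b.hasSum_repr x

theorem aux_coord_le (b : HilbertBasis ℕ ℂ H) (x : H) (k : ℕ) : ‖inner ℂ (b k) x‖ ≤ ‖x‖ := by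
  have := norm_inner_le_norm (𝕜 := ℂ) (b k) x
  rwa [b.orthonormal.1 k, one_mul] at this

theorem aux_inner_bb (b : HilbertBasis ℕ ℂ H) (k l : ℕ) :
    inner ℂ (b k) (b l) = if k = l then (1:ℂ) else 0 :=
  orthonormal_iff_ite.mp b.orthonormal k l

theorem aux_ext (b : HilbertBasis ℕ ℂ H) (x : H) (h : ∀ k, inner ℂ (b k) x = 0) : x = 0 := by
  have := aux_coord b x
  simp only [h, zero_smul] at this
  exact this.unique hasSum_zero |>.symm ▸ rfl

theorem aux_col (b : HilbertBasis ℕ ℂ H) (v : ℕ → H) (hv : Summable fun k => ‖v k‖) :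
    ∃ A : H →L[ℂ] H, (∀ k, A (b k) = v k) ∧ (∀ x, HasSum (fun k => inner ℂ (b k) x • v k) (A x)) ∧
      ‖A‖ ≤ ∑' k, ‖v k‖ := by
  have hs' : Summable fun k => ‖rankOne ℂ (v k) (b k)‖ := by
    simpa [norm_rankOne, b.orthonormal.1] using hv
  have hs : Summable fun k => rankOne ℂ (v k) (b k) := hs'.of_norm
  have hsum : ∀ x, HasSum (fun k => inner ℂ (b k) x • v k) ((∑' k, rankOne ℂ (v k) (b k)) x) := by
    intro x
    simpa using hs.hasSum.mapL (ContinuousLinearMap.apply ℂ H x)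
  refine ⟨∑' k, rankOne ℂ (v k) (b k), fun k => ?_, hsum, ?_⟩
  · have h1 := hsum (b k)
    have h2 : HasSum (fun l => inner ℂ (b l) (b k) • v l) (v k) := by
      have := hasSum_ite_eq k (v k)
      convert this using 2 with l
      rw [aux_inner_bb]; by_cases h : l = k <;> simp [h]
    exact h1.unique h2
  · have := norm_tsum_le_tsum_norm hs'
    simpa [norm_rankOne, b.orthonormal.1] using this
end

end

section
open Filter Topology InnerProductSpace
section
variable {H : Type} [NormedAddCommGroup H] [InnerProductSpace ℂ H] [CompleteSpace H]

theorem aux_PN (A : ℕ → ℝ) : ∃ (P N : ℕ → ℕ), P 0 = 1 ∧ (∀ k, P (k+1) = P k * (2 * N k)) ∧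
    (∀ k, 1 ≤ N k) ∧ (∀ k, A k ≤ N k) ∧ (∀ k, 1 ≤ P k) ∧ (∀ k l, k ≤ l → P k ∣ P l) := by
  let N : ℕ → ℕ := fun k => ⌈A k⌉₊ + 1
  let P : ℕ → ℕ := fun k => ∏ j ∈ Finset.range k, (2 * N j)
  have hPs : ∀ k, P (k+1) = P k * (2 * N k) := fun k => Finset.prod_range_succ _ _
  refine ⟨P, N, by simp [P], hPs, fun k => by simp [N], fun k => ?_, fun k => ?_, fun k l hkl => ?_⟩
  · have := Nat.le_ceil (A k)
    simp only [N]; push_cast; linarith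
  · have : 0 < P k := Finset.prod_pos (fun j _ => by positivity)
    exact this
  · exact Finset.prod_dvd_prod_of_subset _ _ _ (Finset.range_mono hkl)

theorem aux_exp_lip (x y : ℝ) : ‖Complex.exp (Complex.I * x) - Complex.exp (Complex.I * y)‖ ≤ |x - y| := by
  have h1 : Complex.exp (Complex.I * x) - Complex.exp (Complex.I * y)
      = Complex.exp (Complex.I * y) * (Complex.exp (Complex.I * ((x - y : ℝ) : ℂ)) - 1) := by
    rw [mul_sub, ← Complex.exp_add, mul_one]
    congr 2; push_cast; ring
  rw [h1, norm_mul, mul_comm Complex.I, Complex.norm_exp_ofReal_mul_I, one_mul]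
  exact Real.norm_exp_I_mul_ofReal_sub_one_le

/-- approximating an arbitrary angle by one of the form `π j / N` with `j ≤ 2 N` -/
theorem aux_angle (N : ℕ) (hN : 1 ≤ N) (θ : ℝ) : ∃ j : ℕ, j ≤ 2 * N ∧
    ‖Complex.exp (Complex.I * ((Real.pi * j / N : ℝ) : ℂ)) - Complex.exp (Complex.I * θ)‖ ≤ Real.pi / N := by
  have hpi := Real.pi_pos
  have hN' : (0:ℝ) < N := by exact_mod_cast hN
  obtain ⟨θ', h0, h1, h2⟩ : ∃ θ' : ℝ, 0 ≤ θ' ∧ θ' ≤ 2 * Real.pi ∧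
      Complex.exp (Complex.I * θ') = Complex.exp (Complex.I * θ) := by
    refine ⟨toIcoMod Real.two_pi_pos 0 θ, ?_, ?_, ?_⟩
    · exact (toIcoMod_mem_Ico Real.two_pi_pos 0 θ).1
    · have := (toIcoMod_mem_Ico Real.two_pi_pos 0 θ).2; simp at this; exact this.le
    · rw [toIcoMod]
      rw [Complex.exp_eq_exp_iff_exists_int]
      refine ⟨-toIcoDiv Real.two_pi_pos 0 θ, ?_⟩
      push_cast; simp; ring
  refine ⟨⌊θ' * N / Real.pi⌋₊, ?_, ?_⟩
  · apply Nat.floor_le_of_le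
    rw [div_le_iff₀ hpi]; push_cast; nlinarith
  · rw [← h2]
    refine (aux_exp_lip _ _).trans ?_
    have ha : (⌊θ' * N / Real.pi⌋₊ : ℝ) ≤ θ' * N / Real.pi := Nat.floor_le (by positivity)
    have hb := Nat.lt_floor_add_one (θ' * N / Real.pi)
    rw [le_div_iff₀ hpi] at ha
    rw [div_lt_iff₀ hpi] at hb
    rw [abs_le]
    constructor
    · rw [neg_le_sub_iff_le_add, ← add_div, le_div_iff₀ hN']; linarith
    · rw [sub_le_iff_le_add]
      rw [div_le_iff₀ hN', add_mul, div_mul_cancel₀ _ hN'.ne']; linarith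

theorem aux_T (b : HilbertBasis ℕ ℂ H) (i : ℕ → ℕ) (hi : ∀ k, 1 ≤ k → i k < k)
    (R : ℕ → ℝ) (hR : ∀ k, 1 ≤ R k) :
    ∃ (T : H →L[ℂ] H) (g : ℕ → H) (P : ℕ → ℕ), g 0 = b 0 ∧
      (∀ k, 1 ≤ k → g k = b k + (R k : ℂ) • g (i k)) ∧ T (b 0) = b 0 ∧
      (∀ c k, c < k → ∀ j, (T ^ (P k * j)) (g c) = g c) ∧
      (∀ k l, k ≤ l → P k ∣ P l) ∧
      (∀ x, ∀ δ > 0, ∃ K, ∀ k ≥ K, 1 ≤ k → ∀ θ : ℝ, ∃ j, ‖(T ^ (P k * j)) x - x -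
        (inner ℂ (b k) x * R k * (Complex.exp (Complex.I * θ) - 1)) • g (i k)‖ ≤ δ) ∧
      (∀ k, 1 ≤ k → ∃ m, ∀ x, ‖(T ^ m) x - x + (2 * R k * inner ℂ (b k) x) • g (i k)‖ ≤ 3 * ‖x‖) := by
  obtain ⟨g, hg0, hg⟩ := aux_rec i hi (b 0) (fun k y => b k + (R k : ℂ) • y)
  obtain ⟨P, N, hP0, hP, hN1, hNA, hP1, hPd⟩ := aux_PN (fun k => Real.pi * R k * (‖g (i k)‖ + 1) * 4 ^ k)
  let ζ : ℕ → ℕ → ℂ := fun k m => Complex.exp (Complex.I * ((2 * Real.pi * m / P (k+1) : ℝ) : ℂ))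
  have hPpos : ∀ k, (0:ℝ) < P k := fun k => by exact_mod_cast hP1 k
  have hζpow : ∀ k m, (ζ k 1) ^ m = ζ k m := by
    intro k m
    simp only [ζ]
    rw [← Complex.exp_nat_mul]; congr 1; push_cast; ring
  have hζ1 : ∀ k, ζ k (P (k+1)) = 1 := by
    intro k
    simp only [ζ]
    rw [mul_div_cancel_right₀ _ (hPpos _).ne', Complex.exp_eq_one_iff]
    exact ⟨1, by push_cast; ring⟩
  have hζn : ∀ k m, ‖ζ k m‖ = 1 := by
    intro k m; simp only [ζ]; rw [mul_comm, Complex.norm_exp_ofReal_mul_I]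
  obtain ⟨lam, hl0, hl⟩ := aux_rec i hi (1:ℂ) (fun k z => z * ζ k 1)
  have hln : ∀ k, ‖lam k‖ = 1 := by
    intro k
    induction k using Nat.strong_induction_on with
    | _ k ih =>
      rcases Nat.eq_zero_or_pos k with rfl | hk
      · simp [hl0]
      · rw [hl k hk, norm_mul, ih _ (hi k hk), hζn, one_mul]
  have hlP : ∀ k n, k < n → ∀ j, lam k ^ (P n * j) = 1 := by
    intro k
    induction k using Nat.strong_induction_on with
    | _ k ih =>
      intro n hkn j
      rcases Nat.eq_zero_or_pos k with rfl | hk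
      · simp [hl0]
      · rw [hl k hk, mul_pow, ih _ (hi k hk) n ((hi k hk).trans hkn), one_mul]
        obtain ⟨c, hc⟩ := hPd (k+1) n hkn
        rw [hc, mul_assoc, pow_mul, hζpow, hζ1, one_pow]
  obtain ⟨D, hD⟩ := aux_perm b (Equiv.refl ℕ) lam hln
  simp only [Equiv.refl_apply] at hD
  let col : ℕ → ℕ → H := fun m k => if k = 0 then 0 else
    ((R k : ℂ) * (lam k ^ m - lam (i k) ^ m)) • g (i k)
  have hcol : ∀ m k, 1 ≤ k → col m k = (lam (i k) ^ m * (R k * (ζ k m - 1))) • g (i k) := by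
    intro m k hk
    simp only [col, if_neg (by omega : k ≠ 0)]
    congr 1
    rw [hl k hk, mul_pow, hζpow]; ring
  have hRpos : ∀ k, 0 < R k := fun k => lt_of_lt_of_le one_pos (hR k)
  have hNpos : ∀ k, (0:ℝ) < N k := fun k => by exact_mod_cast hN1 k
  have hNA' : ∀ k, R k * ‖g (i k)‖ * (Real.pi / N k) ≤ (1/4)^k := by
    intro k
    have h1 := hNA k
    have hpi := Real.pi_pos
    have h4 : (0:ℝ) < 4^k := by positivity
    rw [one_div, inv_pow, ← one_div, le_div_iff₀ h4, mul_div_assoc', div_mul_eq_mul_div, div_le_one (hNpos k)]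
    refine le_trans ?_ h1
    have : 0 ≤ Real.pi * R k * 4 ^ k := by have := hRpos k; positivity
    nlinarith
  have hcolb : ∀ m k, m ≤ P k → ‖col m k‖ ≤ (1/4)^k := by
    intro m k hm
    rcases Nat.eq_zero_or_pos k with rfl | hk
    · simp [col]
    · rw [hcol m k hk, norm_smul, norm_mul, norm_pow, hln, one_pow, one_mul, norm_mul,
        Complex.norm_real, Real.norm_of_nonneg (hRpos k).le]
      refine le_trans ?_ (hNA' k)
      have : ‖ζ k m - 1‖ ≤ Real.pi / N k := by
        simp only [ζ]
        refine Real.norm_exp_I_mul_ofReal_sub_one_le.trans ?_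
        have hpi := Real.pi_pos
        rw [Real.norm_of_nonneg (by have := hPpos (k+1); positivity), hP]
        have h2 : (m:ℝ) ≤ P k := by exact_mod_cast hm
        have h3 := hPpos k
        have h4 := hNpos k
        push_cast
        rw [div_le_div_iff₀ (by positivity) h4]
        nlinarith [mul_le_mul_of_nonneg_left h2 (by positivity : 0 ≤ 2 * Real.pi * N k)]
      have h5 := hRpos k
      calc R k * ‖ζ k m - 1‖ * ‖g (i k)‖ = R k * ‖g (i k)‖ * ‖ζ k m - 1‖ := by ring
        _ ≤ _ := by gcongr
  obtain ⟨A, hA, -, -⟩ := aux_col b (col 1) (by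
    refine Summable.of_nonneg_of_le (fun _ => norm_nonneg _) (fun k => hcolb 1 k (hP1 k)) ?_
    exact summable_geometric_of_lt_one (by norm_num) (by norm_num))
  let T : H →L[ℂ] H := (D.toContinuousLinearEquiv : H →L[ℂ] H) + A
  have hTb : ∀ k, T (b k) = lam k • b k + col 1 k := by
    intro k; simp [T, hD, hA]
  have hTg : ∀ k, T (g k) = lam k • g k := by
    intro k
    induction k using Nat.strong_induction_on with
    | _ k ih =>
      rcases Nat.eq_zero_or_pos k with rfl | hk
      · rw [hg0, hTb]; simp [col]
      · rw [hg k hk, map_add, map_smul, ih _ (hi k hk), hTb]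
        simp only [col, if_neg (by omega : k ≠ 0)]
        simp only [pow_one]
        module
  have hTmg : ∀ k m, (T ^ m) (g k) = lam k ^ m • g k := by
    intro k m
    induction m with
    | zero => simp
    | succ m ih => rw [pow_succ', mul_apply_eq_comp, ih, map_smul, hTg, smul_smul, pow_succ]
  have hTmb : ∀ m k, (T ^ m) (b k) = lam k ^ m • b k + col m k := by
    intro m k
    rcases Nat.eq_zero_or_pos k with rfl | hk
    · rw [← hg0, hTmg]; simp [col]
    · have h1 : b k = g k - (R k : ℂ) • g (i k) := by rw [hg k hk]; simp
      rw [h1, map_sub, map_smul, hTmg, hTmg]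
      simp only [col, if_neg (by omega : k ≠ 0)]
      module
  let Dc : H →L[ℂ] H := (D.toContinuousLinearEquiv : H →L[ℂ] H)
  have hDn : ∀ m x, ‖(Dc ^ m) x‖ = ‖x‖ := by
    intro m x
    induction m with
    | zero => simp
    | succ m ih => rw [pow_succ', mul_apply_eq_comp, ← ih]; simp [Dc]
  have hDmb : ∀ m k, (Dc ^ m) (b k) = lam k ^ m • b k := by
    intro m k
    induction m with
    | zero => simp
    | succ m ih =>
      rw [pow_succ', mul_apply_eq_comp, ih, map_smul]; simp [Dc, hD, smul_smul, pow_succ]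
  have hsum : ∀ m x, HasSum (fun k => inner ℂ (b k) x • col m k) ((T^m) x - (Dc^m) x) := by
    intro m x
    have h1 := (aux_coord b x).mapL (T^m)
    have h2 := (aux_coord b x).mapL (Dc^m)
    convert h1.sub h2 using 2 with k
    rw [map_smul, map_smul, hTmb, hDmb]; simp
  -- key estimate
  have key : ∀ k, 1 ≤ k → ∀ j ≤ 2 * N k, ∀ x, ‖(T ^ (P k * j)) x - (Dc ^ (P k * j)) x -
      (inner ℂ (b k) x * (R k * (ζ k (P k * j) - 1))) • g (i k)‖ ≤ 2 * (1/2)^k * ‖x‖ := by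
    intro k hk j hj x
    set m := P k * j with hm
    have hcz : ∀ l < k, col m l = 0 := by
      intro l hl'
      by_cases h : l = 0
      · simp [col, h]
      · simp only [col, if_neg h]
        rw [hm, hlP l k hl', hlP (i l) k ((hi l (by omega)).trans hl')]; simp
    have hck : col m k = (R k * (ζ k m - 1)) • g (i k) := by
      rw [hcol m k hk, hm, hlP (i k) k (hi k hk), one_mul]
    have h1 := (hsum m x).sub (hasSum_ite_eq k (inner ℂ (b k) x • col m k))
    have h2 : HasSum (fun l : ℕ => (1/2:ℝ)^k * ‖x‖ * (1/2)^l) ((1/2)^k * ‖x‖ * 2) := by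
      have : HasSum (fun l : ℕ => (1/2:ℝ)^l) 2 := hasSum_geometric_two
      exact this.mul_left _
    have h3 := tsum_of_norm_bounded (f := fun l => inner ℂ (b l) x • col m l - if l = k then inner ℂ (b k) x • col m k else 0) h2 (by
      intro l
      rcases lt_trichotomy l k with h | h | h
      · simp only [hcz l h, if_neg h.ne]; simp
      · subst h; simp
      · rw [if_neg h.ne', sub_zero, norm_smul]
        have hml : m ≤ P l := by
          calc m ≤ P k * (2 * N k) := by rw [hm]; gcongr
            _ = P (k+1) := (hP k).symm
            _ ≤ P l := Nat.le_of_dvd (hP1 l) (hPd _ _ h)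
        calc ‖inner ℂ (b l) x‖ * ‖col m l‖ ≤ ‖x‖ * (1/4)^l := by
              gcongr
              · exact aux_coord_le b x l
              · exact hcolb m l hml
          _ = ‖x‖ * ((1/2)^l * (1/2)^l) := by rw [← mul_pow]; norm_num
          _ ≤ ‖x‖ * ((1/2)^k * (1/2)^l) := by
              have : (1/2:ℝ)^l ≤ (1/2)^k := pow_le_pow_of_le_one (by norm_num) (by norm_num) h.le
              gcongr
          _ = _ := by ring)
    rw [h1.tsum_eq, hck, smul_smul] at h3
    linarith
  have hζj : ∀ k j, ζ k (P k * j) = Complex.exp (Complex.I * ((Real.pi * j / N k : ℝ) : ℂ)) := by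
    intro k j
    simp only [ζ]
    congr 3
    rw [hP]; push_cast
    have := (hPpos k).ne'
    have := (hNpos k).ne'
    field_simp
  have hDs : ∀ x, ∀ δ > 0, ∃ K, ∀ k ≥ K, ∀ j, ‖(Dc ^ (P k * j)) x - x‖ ≤ δ := by
    intro x δ hδ
    have hspan : ∀ y ∈ Submodule.span ℂ (Set.range b), ∃ K, ∀ k ≥ K, ∀ j, (Dc ^ (P k * j)) y = y := by
      intro y hy
      induction hy using Submodule.span_induction with
      | mem y hy =>
        obtain ⟨l, rfl⟩ := hy
        exact ⟨l+1, fun k hk j => by rw [hDmb, hlP l k hk]; simp⟩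
      | zero => exact ⟨0, fun k _ j => by simp⟩
      | add y z _ _ hy hz =>
        obtain ⟨K, hK⟩ := hy
        obtain ⟨L, hL⟩ := hz
        exact ⟨max K L, fun k hk j => by
          rw [map_add, hK k (le_trans (le_max_left _ _) hk), hL k (le_trans (le_max_right _ _) hk)]⟩
      | smul a y _ hy =>
        obtain ⟨K, hK⟩ := hy
        exact ⟨K, fun k hk j => by rw [map_smul, hK k hk]⟩
    have hd : Dense (Submodule.span ℂ (Set.range b) : Set H) :=
      Submodule.dense_iff_topologicalClosure_eq_top.mpr b.dense_span
    obtain ⟨y, hy, hxy⟩ := Metric.dense_iff.mp hd x (δ/2) (by linarith)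
    rw [Metric.mem_ball, dist_eq_norm] at hy
    obtain ⟨K, hK⟩ := hspan y hxy
    refine ⟨K, fun k hk j => ?_⟩
    have h1 : (Dc ^ (P k * j)) x - x = (y - x) - (Dc ^ (P k * j)) (y - x) := by
      rw [map_sub, hK k hk]; abel
    rw [h1]
    refine (norm_sub_le _ _).trans ?_
    rw [hDn]; linarith
  refine ⟨T, g, P, hg0, hg, ?_, ?_, hPd, ?_, ?_⟩
  · rw [hTb]; simp [col, hl0]
  · intro c k hck j
    rw [hTmg, hlP c k hck, one_smul]
  · intro x δ hδ
    obtain ⟨K, hK⟩ := hDs x (δ/2) (by linarith)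
    have ht : Tendsto (fun k : ℕ => 3 * ‖x‖ * (1/2:ℝ)^k) atTop (𝓝 (3 * ‖x‖ * 0)) :=
      (tendsto_pow_atTop_nhds_zero_of_lt_one (by norm_num) (by norm_num)).const_mul _
    rw [mul_zero] at ht
    obtain ⟨K', hK'⟩ := eventually_atTop.mp (ht.eventually_le_const (show (0:ℝ) < δ/2 by linarith))
    refine ⟨max K K', fun k hk hk1 θ => ?_⟩
    obtain ⟨j, hj, hjθ⟩ := aux_angle (N k) (hN1 k) θ
    refine ⟨j, ?_⟩
    have e1 := key k hk1 j hj x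
    have e2 := hK k (le_trans (le_max_left _ _) hk) j
    have e3 := hK' k (le_trans (le_max_right _ _) hk)
    rw [hζj] at e1
    set E := Complex.exp (Complex.I * ((Real.pi * j / N k : ℝ) : ℂ))
    set E' := Complex.exp (Complex.I * θ)
    have e4 : ‖(inner ℂ (b k) x * R k * (E - E')) • g (i k)‖ ≤ ‖x‖ * (1/2)^k := by
      rw [norm_smul, norm_mul, norm_mul, Complex.norm_real, Real.norm_of_nonneg (hRpos k).le]
      have h5 := hRpos k
      calc ‖inner ℂ (b k) x‖ * R k * ‖E - E'‖ * ‖g (i k)‖ ≤ ‖x‖ * R k * (Real.pi / N k) * ‖g (i k)‖ := by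
            gcongr
            exact aux_coord_le b x k
        _ = ‖x‖ * (R k * ‖g (i k)‖ * (Real.pi / N k)) := by ring
        _ ≤ ‖x‖ * (1/4)^k := by gcongr; exact hNA' k
        _ ≤ ‖x‖ * (1/2)^k := by gcongr; norm_num
    have e5 : (T ^ (P k * j)) x - x - (inner ℂ (b k) x * R k * (E' - 1)) • g (i k)
        = ((T ^ (P k * j)) x - (Dc ^ (P k * j)) x - (inner ℂ (b k) x * (R k * (E - 1))) • g (i k))
          + ((Dc ^ (P k * j)) x - x) + (inner ℂ (b k) x * R k * (E - E')) • g (i k) := by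
      module
    rw [e5]
    refine (norm_add₃_le).trans ?_
    linarith
  · intro k hk
    refine ⟨P k * N k, fun x => ?_⟩
    have e1 := key k hk (N k) (by omega) x
    rw [hζj, mul_div_cancel_right₀ _ (hNpos k).ne', mul_comm Complex.I, Complex.exp_pi_mul_I] at e1
    have e5 : (T ^ (P k * N k)) x - x + (2 * R k * inner ℂ (b k) x) • g (i k)
        = ((T ^ (P k * N k)) x - (Dc ^ (P k * N k)) x - (inner ℂ (b k) x * (R k * (-1 - 1))) • g (i k))
          + ((Dc ^ (P k * N k)) x - x) := by
      module
    rw [e5]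
    refine (norm_add_le _ _).trans ?_
    have h2 := norm_sub_le ((Dc ^ (P k * N k)) x) x
    rw [hDn] at h2
    have h3 : (1/2:ℝ)^k ≤ 1/2 := by
      have := pow_le_pow_of_le_one (by norm_num : (0:ℝ) ≤ 1/2) (by norm_num) hk
      simpa using this
    have h4 : 2 * (1/2:ℝ)^k * ‖x‖ ≤ 2 * (1/2) * ‖x‖ := by gcongr
    exact (add_le_add e1 h2).trans (by linarith)
end

end

section
open Filter Topology InnerProductSpace

theorem aux_scalar (i : ℕ → ℕ) (c : ℕ) (W : Set ℂ) (ξ : ℕ → ℂ) (R ε : ℕ → ℝ) (X : ℝ)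
    (hX : ∀ k, ‖ξ k‖ ≤ X) (hR : ∀ k, 1 ≤ R k) (hε0 : ∀ k, 0 < ε k) (hε1 : ∀ k, ε k ≤ 1)
    (hRε : ∀ k : ℕ, (k:ℝ) ≤ R k * ε k ^ 2)
    (hW0 : (0:ℂ) ∈ W)
    (hA : ∀ z, (∀ δ > 0, ∀ N, ∃ k ≥ N, 1 ≤ k ∧ i k = c ∧ ∃ θ : ℝ, ∃ t ∈ W,
      ‖ξ k * R k * (Complex.exp (Complex.I * θ) - 1) + t - z‖ ≤ δ) → z ∈ W)
    (hnb : ∀ α : ℂ, ‖α‖ = 1 → ∀ n0, ∃ k ≥ n0, i k = c ∧ ε k < |((starRingEnd ℂ) α * ξ k).im|) :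
    ∀ z, z ∈ W := by
  have hRpos : ∀ k, 0 < R k := fun k => lt_of_lt_of_le one_pos (hR k)
  choose κ hκ1 hκ2 hκ3 using fun n => hnb 1 (by simp) n
  have hbig : ∀ n : ℕ, (n:ℝ) ≤ ‖ξ (κ n) * R (κ n)‖ := by
    intro n
    rw [norm_mul, Complex.norm_real, Real.norm_of_nonneg (hRpos _).le]
    have h1 := hκ3 n
    simp only [map_one, one_mul] at h1
    have h2 := h1.le.trans (Complex.abs_im_le_norm _)
    have h3 : (n:ℝ) ≤ κ n := by exact_mod_cast hκ1 n
    have h4 := hRε (κ n)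
    have h5 := hε0 (κ n)
    have h6 := hε1 (κ n)
    have h7 := hRpos (κ n)
    have h8 : R (κ n) * ε (κ n)^2 ≤ R (κ n) * ε (κ n) := by
      apply mul_le_mul_of_nonneg_left _ h7.le; nlinarith
    nlinarith
  let u : ℕ → ℂ := fun n => ξ (κ (n+1)) * R (κ (n+1)) / ‖ξ (κ (n+1)) * R (κ (n+1))‖
  have hpos : ∀ n : ℕ, 0 < ‖ξ (κ (n+1)) * R (κ (n+1))‖ := by
    intro n
    have := hbig (n+1)
    push_cast at this
    have h0 : (0:ℝ) ≤ n := n.cast_nonneg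
    linarith
  have hu : ∀ n, u n ∈ Metric.sphere (0:ℂ) 1 := by
    intro n
    have := hpos n
    simp only [mem_sphere_zero_iff_norm, u]
    rw [norm_div, Complex.norm_real, norm_norm, div_self this.ne']
  obtain ⟨α, hα, φ, hφ, hlim⟩ := (isCompact_sphere (0:ℂ) 1).tendsto_subseq hu
  have hα1 : ‖α‖ = 1 := by simpa using hα
  have B1 : ∀ τ : ℝ, Complex.I * α * τ ∈ W := by
    intro τ
    apply hA
    intro δ hδ N
    have hl : Tendsto (fun n : ℕ => τ^2 / (n:ℝ) + ‖u (φ n) - α‖ * |τ|) atTop (𝓝 (0 + 0 * |τ|)) := by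
      apply Tendsto.add
      · exact tendsto_const_div_atTop_nhds_zero_nat _
      · apply Tendsto.mul_const
        have := (hlim.sub_const α).norm
        simpa using this
    rw [zero_mul, add_zero] at hl
    obtain ⟨n, h1, h2, h3⟩ := ((hl.eventually_le_const hδ).and
      ((eventually_ge_atTop (N+1)).and (eventually_ge_atTop (⌈|τ|⌉₊ + 1)))).exists
    have hφn := hφ.id_le n
    simp only [id] at hφn
    have hk : φ n + 1 ≤ κ (φ n + 1) := hκ1 (φ n + 1)
    refine ⟨κ (φ n + 1), by omega, by omega, hκ2 _, τ / ‖ξ (κ (φ n+1)) * R (κ (φ n+1))‖, 0, hW0, ?_⟩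
    have hb := hbig (φ n + 1)
    have hp := hpos (φ n)
    have hudef : ξ (κ (φ n+1)) * R (κ (φ n+1)) = ‖ξ (κ (φ n+1)) * R (κ (φ n+1))‖ * u (φ n) := by
      simp only [u]
      rw [mul_div_cancel₀]
      exact_mod_cast hp.ne'
    set a := ξ (κ (φ n+1)) * R (κ (φ n+1)) with ha
    have hun : ‖u (φ n)‖ = 1 := by simpa using hu (φ n)
    set v := u (φ n)
    have hn1 : (n:ℝ) ≤ ‖a‖ := by
      refine le_trans ?_ hb
      exact_mod_cast hφn.trans (Nat.le_succ _)
    have hn0 : (0:ℝ) < n := by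
      have : 0 < n := by omega
      exact_mod_cast this
    have hτn : |τ| ≤ ‖a‖ := by
      refine le_trans (Nat.le_ceil _) (le_trans ?_ hn1)
      exact_mod_cast (by omega : ⌈|τ|⌉₊ ≤ n)
    have hx : ‖Complex.I * ((τ / ‖a‖ : ℝ) : ℂ)‖ = |τ| / ‖a‖ := by
      rw [norm_mul, Complex.norm_I, one_mul, Complex.norm_real, Real.norm_eq_abs, abs_div, abs_norm]
    have he := Complex.norm_exp_sub_one_sub_id_le (x := Complex.I * ((τ / ‖a‖ : ℝ) : ℂ)) (by
      rw [hx]; exact div_le_one_of_le₀ hτn (norm_nonneg _))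
    rw [hx] at he
    have hane : (‖a‖ : ℂ) ≠ 0 := by exact_mod_cast hp.ne'
    have heq : (‖a‖:ℂ) * v * (Complex.exp (Complex.I * ((τ / ‖a‖ : ℝ) : ℂ)) - 1) + 0 - Complex.I * α * τ
        = ‖a‖ * v * (Complex.exp (Complex.I * ((τ / ‖a‖ : ℝ) : ℂ)) - 1 - Complex.I * ((τ / ‖a‖ : ℝ) : ℂ))
          + (v - α) * (Complex.I * τ) := by
      push_cast
      field_simp
      ring
    clear_value a v
    have heq2 := heq
    nth_rewrite 1 [← hudef] at heq2
    rw [heq2]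
    refine (norm_add_le _ _).trans (le_trans ?_ h1)
    rw [norm_mul, norm_mul, Complex.norm_real, norm_norm, hun, mul_one, norm_mul, norm_mul,
      Complex.norm_I, one_mul, Complex.norm_real, Real.norm_eq_abs]
    gcongr
    calc ‖a‖ * ‖_‖ ≤ ‖a‖ * (|τ| / ‖a‖)^2 := by gcongr
      _ = τ^2 / ‖a‖ := by rw [div_pow, sq_abs]; field_simp
      _ ≤ τ^2 / n := by gcongr
  have B2 : ∀ r τ : ℝ, α * (r + Complex.I * τ) ∈ W := by
    intro r τ
    apply hA
    intro δ hδ N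
    obtain ⟨k, hk, hik, hεk⟩ := hnb α hα1 (max (N+1) (⌈2 * X * |r|⌉₊))
    have hkN : N + 1 ≤ k := le_trans (le_max_left _ _) hk
    have hkX : 2 * X * |r| ≤ k := by
      refine (Nat.le_ceil _).trans ?_
      exact_mod_cast le_trans (le_max_right _ _) hk
    refine ⟨k, by omega, by omega, hik, ?_⟩
    set a := ξ k * R k with ha
    have hαα : α * (starRingEnd ℂ) α = 1 := by
      rw [Complex.mul_conj, Complex.normSq_eq_norm_sq, hα1]; simp
    set d := (starRingEnd ℂ) α * a with hd
    have had : a = α * d := by rw [hd, ← mul_assoc, hαα, one_mul]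
    have hdn : ‖d‖ = ‖ξ k‖ * R k := by
      rw [hd, ha, norm_mul, RCLike.norm_conj, hα1, one_mul, norm_mul, Complex.norm_real,
        Real.norm_of_nonneg (hRpos _).le]
    have him : R k * ε k < |d.im| := by
      have : d.im = R k * ((starRingEnd ℂ) α * ξ k).im := by
        rw [hd, ha, ← mul_assoc, mul_comm _ (R k : ℂ), Complex.im_ofReal_mul]
      rw [this, abs_mul, abs_of_pos (hRpos k)]
      exact mul_lt_mul_of_pos_left hεk (hRpos k)
    have hsq : ‖d‖^2 = d.re^2 + d.im^2 := by
      rw [← Complex.normSq_eq_norm_sq, Complex.normSq_apply]; ring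
    have hdpos : 0 < ‖d‖ := lt_of_lt_of_le (lt_of_le_of_lt (mul_nonneg (hRpos k).le (hε0 k).le) him)
      (Complex.abs_im_le_norm d)
    have hpr : |d.re + r| ≤ ‖d‖ := by
      refine (abs_add_le _ _).trans ?_
      by_contra hcon
      push Not at hcon
      have hr : ‖d‖ - |d.re| < |r| := by linarith
      have h1 : (‖d‖ - |d.re|) * (‖d‖ + |d.re|) = |d.im|^2 := by
        rw [sq_abs]; nlinarith [sq_abs d.re]
      have h2 : |d.re| ≤ ‖d‖ := Complex.abs_re_le_norm d
      have h3 : |d.im|^2 ≤ |r| * (2 * ‖d‖) := by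
        rw [← h1]; nlinarith [abs_nonneg d.re, abs_nonneg r]
      have h4 : (R k * ε k)^2 < |d.im|^2 := by
        have := mul_nonneg (hRpos k).le (hε0 k).le
        exact pow_lt_pow_left₀ him this (by norm_num)
      have h5 : |r| * (2 * ‖d‖) ≤ R k * k := by
        rw [hdn]
        have := hX k
        have h6 : ‖ξ k‖ * |r| ≤ X * |r| := by gcongr
        nlinarith [hRpos k]
      have h6 : R k * k ≤ (R k * ε k)^2 := by
        have := mul_le_mul_of_nonneg_left (hRε k) (hRpos k).le
        nlinarith
      linarith
    let w := Real.sqrt (‖d‖^2 - (d.re + r)^2)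
    have hw : w^2 = ‖d‖^2 - (d.re+r)^2 := by
      apply Real.sq_sqrt
      have := pow_le_pow_left₀ (abs_nonneg _) hpr 2
      rw [sq_abs] at this; linarith
    have hdne : d ≠ 0 := norm_pos_iff.mp hdpos
    let e : ℂ := ((d.re + r : ℝ) + w * Complex.I) / d
    have hen : ‖e‖ = 1 := by
      simp only [e]
      rw [norm_div, div_eq_one_iff_eq hdpos.ne']
      have : ‖((d.re + r : ℝ) : ℂ) + w * Complex.I‖^2 = ‖d‖^2 := by
        rw [← Complex.normSq_eq_norm_sq, Complex.normSq_add_mul_I]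
        linarith
      exact (pow_left_inj₀ (norm_nonneg _) (norm_nonneg _) (by norm_num)).mp this
    refine ⟨Complex.arg e, Complex.I * α * ((τ - w + d.im : ℝ) : ℂ), B1 _, ?_⟩
    have hexp : Complex.exp (Complex.I * (Complex.arg e : ℂ)) = e := by
      have := Complex.norm_mul_exp_arg_mul_I e
      rw [hen] at this
      rw [mul_comm]; simpa using this
    rw [hexp, had]
    have hde : d * e = (d.re + r : ℝ) + w * Complex.I := by
      simp only [e]; rw [mul_div_cancel₀ _ hdne]
    have hdd : d = d.re + d.im * Complex.I := (Complex.re_add_im d).symm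
    have : α * d * (e - 1) + Complex.I * α * ((τ - w + d.im : ℝ) : ℂ) - α * (r + Complex.I * τ) = 0 := by
      have : α * d * (e - 1) = α * (d * e - d) := by ring
      rw [this, hde]
      nth_rewrite 2 [hdd]
      push_cast; ring
    rw [this]; simpa using hδ.le
  intro z
  have hαα : α * (starRingEnd ℂ) α = 1 := by
    rw [Complex.mul_conj, Complex.normSq_eq_norm_sq, hα1]; simp
  have h := B2 ((starRingEnd ℂ) α * z).re ((starRingEnd ℂ) α * z).im
  rwa [mul_comm Complex.I, Complex.re_add_im, ← mul_assoc, hαα, one_mul] at h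

section
variable {H : Type} [NormedAddCommGroup H] [InnerProductSpace ℂ H] [CompleteSpace H]

def IsBad (b : HilbertBasis ℕ ℂ H) (i : ℕ → ℕ) (ε : ℕ → ℝ) (c : ℕ) (x : H) : Prop :=
  ∃ α : ℂ, ‖α‖ = 1 ∧ ∃ n0, ∀ k ≥ n0, i k = c → |((starRingEnd ℂ) α * inner ℂ (b k) x).im| ≤ ε k

theorem aux_hyp (b : HilbertBasis ℕ ℂ H) (i : ℕ → ℕ) (R ε : ℕ → ℝ) (hR : ∀ k, 1 ≤ R k)
    (hε0 : ∀ k, 0 < ε k) (hε1 : ∀ k, ε k ≤ 1) (hRε : ∀ k : ℕ, (k:ℝ) ≤ R k * ε k ^ 2)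
    (T : H →L[ℂ] H) (g : ℕ → H) (P : ℕ → ℕ) (hg0 : g 0 = b 0)
    (hg : ∀ k, 1 ≤ k → g k = b k + (R k : ℂ) • g (i k))
    (hTg : ∀ c k, c < k → ∀ j, (T ^ (P k * j)) (g c) = g c)
    (hT : ∀ x, ∀ δ > 0, ∃ K, ∀ k ≥ K, 1 ≤ k → ∀ θ : ℝ, ∃ j, ‖(T ^ (P k * j)) x - x -
        (inner ℂ (b k) x * R k * (Complex.exp (Complex.I * θ) - 1)) • g (i k)‖ ≤ δ)
    (x : H) (hx : ∀ c, ¬ IsBad b i ε c x) : Dense (Set.range fun n : ℕ => (T ^ n) x) := by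
  set C := closure (Set.range fun n : ℕ => (T ^ n) x) with hC
  have hCT : ∀ m, ∀ y ∈ C, (T^m) y ∈ C := by
    intro m y hy
    have : Set.MapsTo (T^m) (Set.range fun n : ℕ => (T ^ n) x) (Set.range fun n : ℕ => (T ^ n) x) := by
      rintro _ ⟨n, rfl⟩
      exact ⟨m + n, by simp [pow_add]⟩
    exact this.closure (T^m).continuous hy
  have hCc : IsClosed C := isClosed_closure
  let Fix : H → Prop := fun v => ∃ N, ∀ k ≥ N, ∀ j, (T ^ (P k * j)) v = v
  have hFadd : ∀ v w, Fix v → Fix w → Fix (v + w) := by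
    rintro v w ⟨N, hN⟩ ⟨M, hM⟩
    exact ⟨max N M, fun k hk j => by
      rw [map_add, hN k (le_trans (le_max_left _ _) hk), hM k (le_trans (le_max_right _ _) hk)]⟩
  have hFsmul : ∀ (a : ℂ) v, Fix v → Fix (a • v) := by
    rintro a v ⟨N, hN⟩
    exact ⟨N, fun k hk j => by rw [map_smul, hN k hk]⟩
  have hFg : ∀ c, Fix (g c) := fun c => ⟨c+1, fun k hk j => hTg c k hk j⟩
  have hW : ∀ c, ∀ z : ℂ, ∀ y ∈ C, Fix (y - x) → y + z • g c ∈ C := by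
    intro c
    refine aux_scalar i c {z | ∀ y ∈ C, Fix (y - x) → y + z • g c ∈ C} (fun k => inner ℂ (b k) x) R ε ‖x‖
      (aux_coord_le b x) hR hε0 hε1 hRε ?_ ?_ ?_
    · intro y hy _; simpa using hy
    · intro z hz y hy hfix
      rw [← hCc.closure_eq]
      rw [Metric.mem_closure_iff]
      intro e he
      obtain ⟨K, hK⟩ := hT x (e/3) (by linarith)
      obtain ⟨N, hN⟩ := hfix
      obtain ⟨k, hk, hk1, hik, θ, t, ht, hkt⟩ := hz (e/3/(‖g c‖+1)) (by positivity) (max (max K N) (c+1))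
      obtain ⟨j, hj⟩ := hK k (le_trans (le_trans (le_max_left _ _) (le_max_left _ _)) hk) hk1 θ
      refine ⟨(T^(P k * j)) (y + t • g c), hCT _ _ (ht y hy ⟨N, hN⟩), ?_⟩
      rw [dist_comm, dist_eq_norm]
      have h1 := hN k (le_trans (le_trans (le_max_right _ _) (le_max_left _ _)) hk) j
      rw [map_sub, sub_eq_iff_eq_add] at h1
      have h2 := hTg c k (le_trans (le_max_right _ _) hk) j
      rw [map_add, map_smul, h2, h1]
      rw [hik] at hj
      have h3 : y - x + (T ^ (P k * j)) x + t • g c - (y + z • g c) =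
        ((T ^ (P k * j)) x - x - (inner ℂ (b k) x * R k * (Complex.exp (Complex.I * θ) - 1)) • g c)
        + (inner ℂ (b k) x * R k * (Complex.exp (Complex.I * θ) - 1) + t - z) • g c := by module
      rw [h3]
      refine lt_of_le_of_lt (norm_add_le _ _) ?_
      have h4 : ‖(inner ℂ (b k) x * R k * (Complex.exp (Complex.I * θ) - 1) + t - z) • g c‖ ≤ e/3 := by
        rw [norm_smul]
        calc _ ≤ e/3/(‖g c‖+1) * (‖g c‖+1) := by
              gcongr
              linarith
          _ = e/3 := by field_simp
      linarith
    · intro α hα n0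
      have := hx c
      simp only [IsBad, not_exists, not_and, not_forall, not_le] at this
      obtain ⟨k, h1, h2, h3⟩ := this α hα n0
      exact ⟨k, h1, h2, h3⟩
  have hspan : ∀ v ∈ Submodule.span ℂ (Set.range g), ∀ a : ℂ,
      (∀ y ∈ C, Fix (y - x) → y + a • v ∈ C) ∧ Fix v := by
    intro v hv
    induction hv using Submodule.span_induction with
    | mem y hy => obtain ⟨c, rfl⟩ := hy; exact fun a => ⟨hW c a, hFg c⟩
    | zero => exact fun a => ⟨fun y hy _ => by simpa using hy, ⟨0, by simp⟩⟩
    | add v w _ _ hv hw =>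
      intro a
      refine ⟨fun y hy hf => ?_, hFadd _ _ (hv a).2 (hw a).2⟩
      rw [smul_add, ← add_assoc]
      apply (hw a).1 _ ((hv a).1 y hy hf)
      rw [add_sub_right_comm]
      exact hFadd _ _ hf (hFsmul _ _ (hv a).2)
    | smul a' v _ hv =>
      intro a
      refine ⟨fun y hy hf => ?_, hFsmul _ _ (hv a).2⟩
      rw [smul_smul]; exact (hv _).1 y hy hf
  have hd : Dense (Submodule.span ℂ (Set.range g) : Set H) := by
    rw [Submodule.dense_iff_topologicalClosure_eq_top, eq_top_iff, ← b.dense_span]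
    apply Submodule.topologicalClosure_mono
    rw [Submodule.span_le]
    rintro _ ⟨k, rfl⟩
    rcases Nat.eq_zero_or_pos k with rfl | hk
    · rw [← hg0]; exact Submodule.subset_span ⟨0, rfl⟩
    · have : b k = g k - (R k : ℂ) • g (i k) := by rw [hg k hk]; simp
      rw [this]
      exact Submodule.sub_mem _ (Submodule.subset_span ⟨k, rfl⟩)
        (Submodule.smul_mem _ _ (Submodule.subset_span ⟨i k, rfl⟩))
  have hxC : x ∈ C := subset_closure ⟨0, by simp⟩
  intro z
  show z ∈ C
  have h1 : Set.MapsTo (fun v => x + v) (Submodule.span ℂ (Set.range g) : Set H) C := by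
    intro v hv
    have := (hspan v hv 1).1 x hxC ⟨0, by simp⟩
    simpa using this
  have h2 := h1.closure (by fun_prop) (hd (z - x))
  rw [hCc.closure_eq] at h2
  simpa using h2
end

end

section
open Filter Topology InnerProductSpace

theorem aux_hasSum_congr {E : Type*} [AddCommMonoid E] [TopologicalSpace E] {f g : ℕ → E} {a : E}
    (hg : HasSum g a) (h : ∀ n, f n = g n) : HasSum f a := by
  rwa [show f = g from funext h]

theorem aux_seq : ∃ (a : ℕ → ℝ) (ρ : ℕ → ℂ), (∀ n, 0 < a n) ∧ (∀ n, a n ≤ 1) ∧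
    (∀ n : ℕ, 1 / ((n:ℝ) + 1) ≤ a n) ∧
    Summable (fun n => a n ^ 2) ∧ (∀ n, ‖ρ n‖ = 1) ∧
    (∀ ζ : ℂ, ‖ζ‖ = 1 → ∀ δ > 0, ∀ N, ∃ n ≥ N, ‖ρ n - ζ‖ ≤ δ * a n) := by
  have hp : ∀ n : ℕ, (0:ℝ) < (n:ℝ) + 1 := fun n => by positivity
  have hp1 : ∀ n : ℕ, (1:ℝ) ≤ (n:ℝ) + 1 := fun n => by have : (0:ℝ) ≤ n := n.cast_nonneg
                                                       linarith
  refine ⟨fun n => (((n:ℝ) + 1) ^ (3/4:ℝ))⁻¹, fun n => Complex.exp (Complex.I * (Real.log ((n:ℝ) + 1) : ℝ)),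
    fun n => inv_pos.mpr (Real.rpow_pos_of_pos (hp n) _), fun n => ?_, fun n => ?_, ?_, fun n => ?_, ?_⟩
  · exact inv_le_one_of_one_le₀ (Real.one_le_rpow (hp1 n) (by norm_num))
  · rw [one_div]
    apply inv_anti₀ (Real.rpow_pos_of_pos (hp n) _)
    calc ((n:ℝ)+1)^(3/4:ℝ) ≤ ((n:ℝ)+1)^(1:ℝ) := Real.rpow_le_rpow_of_exponent_le (hp1 n) (by norm_num)
      _ = _ := Real.rpow_one _
  · have h1 : Summable (fun n : ℕ => ((n:ℝ)^(3/2:ℝ))⁻¹) := Real.summable_nat_rpow_inv.mpr (by norm_num)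
    have h2 := (summable_nat_add_iff 1).mpr h1
    refine (summable_congr fun n => ?_).mpr h2
    rw [inv_pow, ← Real.rpow_natCast, ← Real.rpow_mul (hp n).le]
    push_cast; norm_num
  · show ‖Complex.exp (Complex.I * (Real.log ((n:ℝ) + 1) : ℝ))‖ = 1
    rw [mul_comm, Complex.norm_exp_ofReal_mul_I]
  · intro ζ hζ δ hδ N
    have hexp : Complex.exp (Complex.I * (Complex.arg ζ : ℂ)) = ζ := by
      have := Complex.norm_mul_exp_arg_mul_I ζ
      rw [hζ] at this
      rw [mul_comm]; simpa using this
    -- eventually 1/(n+1) ≤ δ a n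
    have ht : Tendsto (fun n : ℕ => ((n:ℝ)+1)^(-(1/4):ℝ)) atTop (𝓝 0) := by
      have h1 := tendsto_rpow_neg_atTop (show (0:ℝ) < 1/4 by norm_num)
      exact h1.comp (tendsto_atTop_add_const_right _ _ tendsto_natCast_atTop_atTop)
    obtain ⟨N1, hN1⟩ := eventually_atTop.mp (ht.eventually_le_const hδ)
    -- choose angle
    obtain ⟨m, hm⟩ := exists_nat_ge (((N:ℝ) + N1 + 1 - Complex.arg ζ))
    set θ := Complex.arg ζ + m * (2 * Real.pi) with hθ
    have hθ1 : (N:ℝ) + N1 + 1 ≤ θ := by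
      have hpi := Real.pi_gt_three
      have : (m:ℝ) ≤ m * (2 * Real.pi) := by
        have : (0:ℝ) ≤ m := m.cast_nonneg
        nlinarith
      linarith
    have hexp' : Complex.exp (Complex.I * (θ:ℂ)) = ζ := by
      rw [← hexp, Complex.exp_eq_exp_iff_exists_int]
      refine ⟨m, ?_⟩
      rw [hθ]; push_cast; ring
    have hX : (N:ℝ) + N1 + 1 + 1 ≤ Real.exp θ := by
      have := Real.add_one_le_exp θ
      linarith
    set k := ⌊Real.exp θ⌋₊ with hk
    have hk0 : N + N1 + 2 ≤ k := by
      apply Nat.le_floor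
      push_cast; linarith
    have hk1 : (k:ℝ) ≤ Real.exp θ := Nat.floor_le (Real.exp_pos _).le
    have hk2 : Real.exp θ < k + 1 := Nat.lt_floor_add_one _
    have hkc : ((k - 1 : ℕ) : ℝ) + 1 = k := by
      rw [Nat.cast_sub (by omega)]; push_cast; ring
    have hkpos : (0:ℝ) < k := by
      have : 0 < k := by omega
      exact_mod_cast this
    refine ⟨k - 1, by omega, ?_⟩
    have h3 := hN1 (k-1) (by omega)
    rw [hkc] at h3
    simp only [hkc]
    rw [← hexp']
    refine (aux_exp_lip _ _).trans ?_
    have hl1 : Real.log k ≤ θ := by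
      rw [Real.log_le_iff_le_exp hkpos]; exact hk1
    have hl2 : θ ≤ Real.log k + 1 / k := by
      have h4 : θ < Real.log (k+1) := by rw [Real.lt_log_iff_exp_lt (by positivity)]; exact hk2
      have h5 : Real.log (k+1) = Real.log k + Real.log (1 + 1/k) := by
        rw [← Real.log_mul hkpos.ne' (by positivity)]
        congr 1; field_simp
      have h6 := Real.log_le_sub_one_of_pos (show (0:ℝ) < 1 + 1/k by positivity)
      linarith
    have h7 : 1 / (k:ℝ) ≤ δ * ((k:ℝ)^(3/4:ℝ))⁻¹ := by
      have h8 : 1 / (k:ℝ) = (k:ℝ)^(-(1/4):ℝ) * ((k:ℝ)^(3/4:ℝ))⁻¹ := by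
        rw [← Real.rpow_neg hkpos.le, ← Real.rpow_add hkpos, one_div, ← Real.rpow_neg_one]
        norm_num
      rw [h8]
      gcongr
    rw [abs_sub_comm, abs_of_nonneg (by linarith)]
    linarith

section
variable {H : Type} [NormedAddCommGroup H] [InnerProductSpace ℂ H] [CompleteSpace H]

theorem aux_cayley (S : H →L[ℂ] H) (hS : ‖S‖ < 1) (hskew : ContinuousLinearMap.adjoint S = -S) :
    ∃ (E F : H ≃L[ℂ] H) (W : H ≃ₗᵢ[ℂ] H), (∀ u, E u = u - S u) ∧ (∀ u, F u = u + S u) ∧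
      ∀ u, W (E u) = F u := by
  have hE : IsUnit (1 - S) := isUnit_one_sub_of_norm_lt_one hS
  have hF : IsUnit (1 + S) := by
    have := isUnit_one_sub_of_norm_lt_one (x := -S) (by rwa [norm_neg])
    rwa [sub_neg_eq_add] at this
  obtain ⟨e, he⟩ := hE
  obtain ⟨f, hf⟩ := hF
  let E := ContinuousLinearEquiv.unitsEquiv ℂ H e
  let F := ContinuousLinearEquiv.unitsEquiv ℂ H f
  have hEu : ∀ u, E u = u - S u := by
    intro u
    have : E u = (e : H →L[ℂ] H) u := ContinuousLinearEquiv.unitsEquiv_apply _ _ _ _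
    rw [this, he]; simp
  have hFu : ∀ u, F u = u + S u := by
    intro u
    have : F u = (f : H →L[ℂ] H) u := ContinuousLinearEquiv.unitsEquiv_apply _ _ _ _
    rw [this, hf]; simp
  have hre : ∀ u, (inner ℂ u (S u)).re = 0 := by
    intro u
    have h1 : inner ℂ (S u) u = - inner ℂ u (S u) := by
      rw [← ContinuousLinearMap.adjoint_inner_right, hskew]; simp
    have h2 := congrArg Complex.re h1
    rw [← inner_conj_symm, Complex.conj_re, Complex.neg_re] at h2
    linarith
  have hn : ∀ u, ‖u + S u‖ = ‖u - S u‖ := by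
    intro u
    have h1 := norm_add_mul_self (𝕜 := ℂ) u (S u)
    have h2 := norm_sub_mul_self (𝕜 := ℂ) u (S u)
    have h3 := hre u
    simp only [RCLike.re_to_complex, h3] at h1 h2
    have : ‖u + S u‖ * ‖u + S u‖ = ‖u - S u‖ * ‖u - S u‖ := by linarith
    exact (mul_self_inj (norm_nonneg _) (norm_nonneg _)).mp this
  let W : H ≃ₗᵢ[ℂ] H := ⟨(E.symm.trans F).toLinearEquiv, by
    intro x
    have h1 := hn (E.symm x)
    rw [← hEu, ← hFu, E.apply_symm_apply] at h1
    exact h1⟩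
  refine ⟨E, F, W, hEu, hFu, fun u => ?_⟩
  show F (E.symm (E u)) = F u
  rw [E.symm_apply_apply]

theorem aux_p (b : HilbertBasis ℕ ℂ H) (a : ℕ → ℝ) (ha : Summable (fun n => a n ^ 2)) :
    ∃ (p : ℕ → H) (A : ℝ), 0 ≤ A ∧ (∀ L, ‖p L‖ ≤ A) ∧
      ∀ L t, inner ℂ (b t) (p L) = if t.unpair.1 = L then (a t.unpair.2 : ℂ) else 0 := by
  have hmem : Memℓp (fun n => (a n : ℂ)) 2 := by
    apply memℓp_gen
    simpa using ha
  let f : lp (fun _ : ℕ => ℂ) 2 := ⟨fun n => (a n : ℂ), hmem⟩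
  have hinj : ∀ L, Function.Injective (fun n => Nat.pair L n) := by
    intro L m n h
    simpa using h
  have ho : ∀ L, Orthonormal ℂ (fun n => b (Nat.pair L n)) := fun L => b.orthonormal.comp _ (hinj L)
  refine ⟨fun L => (ho L).orthogonalFamily.linearIsometry f, ‖f‖, norm_nonneg _, fun L => ?_, fun L t => ?_⟩
  · rw [LinearIsometry.norm_map]
  · have h1 := (ho L).orthogonalFamily.hasSum_linearIsometry f
    have h2 := h1.mapL (innerSL ℂ (b t))
    simp only [LinearIsometry.toSpanSingleton_apply, innerSL_apply_apply, inner_smul_right, aux_inner_bb] at h2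
    refine h2.unique ?_
    split_ifs with h
    · have h3 := hasSum_ite_eq t.unpair.2 (a t.unpair.2 : ℂ)
      refine aux_hasSum_congr h3 fun n => ?_
      by_cases hn : n = t.unpair.2
      · subst hn; subst h; simp [f]
      · rw [if_neg hn, if_neg]; · simp
        intro h'; apply hn; rw [h']; simp
    · refine aux_hasSum_congr hasSum_zero fun n => ?_
      rw [if_neg]; · simp
      intro h'; apply h; rw [h']; simp

theorem aux_K (b : HilbertBasis ℕ ℂ H) (a : ℕ → ℝ) (ha : Summable (fun n => a n ^ 2)) :
    ∃ (d C : ℝ) (K : H →L[ℂ] H), 0 < d ∧ d ≤ 1 ∧ 0 ≤ C ∧ ‖K‖ ≤ 1/3 ∧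
      (∀ t u, inner ℂ (b t) (K u) = Complex.I ^ (t.unpair.1.unpair.2.unpair.2) *
        ((d * (1/4)^t.unpair.1 * a t.unpair.2 : ℝ) : ℂ) * inner ℂ (b t.unpair.1.unpair.2.unpair.1) u) ∧
      ∀ t, ‖K (b t)‖ ≤ C * (1/2)^t := by
  obtain ⟨p, A, hA, hpA, hp⟩ := aux_p b a ha
  let d : ℝ := 1 / (4 * (A + 1))
  have hd : 0 < d := by positivity
  have hdA : d * A ≤ 1/4 := by
    simp only [d]; rw [div_mul_eq_mul_div, div_le_div_iff₀ (by positivity) (by norm_num)]; linarith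
  let w : ℕ → ℂ := fun L => Complex.I ^ (L.unpair.2.unpair.2) * ((d * (1/4)^L : ℝ) : ℂ)
  have hw : ∀ L, ‖w L‖ = d * (1/4)^L := by
    intro L
    simp only [w]
    rw [norm_mul, norm_pow, Complex.norm_I, one_pow, one_mul, Complex.norm_real, Real.norm_of_nonneg (by positivity)]
  let O : ℕ → H →L[ℂ] H := fun L => w L • rankOne ℂ (p L) (b L.unpair.2.unpair.1)
  have hO : ∀ L, ‖O L‖ ≤ 1/4 * (1/4)^L := by
    intro L
    simp only [O]
    rw [norm_smul, norm_rankOne, b.orthonormal.1, mul_one, hw]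
    calc d * (1/4)^L * ‖p L‖ ≤ d * (1/4)^L * A := by gcongr; exact hpA L
      _ = d * A * (1/4)^L := by ring
      _ ≤ _ := by gcongr
  have hg : HasSum (fun L : ℕ => (1/4:ℝ) * (1/4)^L) (1/4 * (1 - 1/4)⁻¹) :=
    (hasSum_geometric_of_lt_one (by norm_num) (by norm_num)).mul_left _
  have hOs : Summable O := Summable.of_norm_bounded hg.summable hO
  have happ : ∀ u, HasSum (fun L => O L u) ((∑' L, O L) u) := fun u =>
    hOs.hasSum.mapL (ContinuousLinearMap.apply ℂ H u)
  refine ⟨d, 2, ∑' L, O L, hd, ?_, by norm_num, ?_, ?_, ?_⟩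
  · simp only [d]; rw [div_le_one (by positivity)]; linarith
  · have := tsum_of_norm_bounded hg hO
    norm_num at this ⊢; exact this
  · intro t u
    have h2 := (happ u).mapL (innerSL ℂ (b t))
    simp only [innerSL_apply_apply] at h2
    refine h2.unique ?_
    have h3 := hasSum_ite_eq t.unpair.1 (Complex.I ^ (t.unpair.1.unpair.2.unpair.2) *
        ((d * (1/4)^t.unpair.1 * a t.unpair.2 : ℝ) : ℂ) * inner ℂ (b t.unpair.1.unpair.2.unpair.1) u)
    refine aux_hasSum_congr h3 fun L => ?_
    simp only [O, w, _root_.smul_apply, rankOne_apply, inner_smul_right, hp]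
    by_cases h : t.unpair.1 = L
    · subst h; simp; ring
    · rw [if_neg h, if_neg (Ne.symm h)]; simp
  · intro t
    rw [← (happ (b t)).tsum_eq]
    have hg2 : HasSum (fun L : ℕ => (1/2:ℝ)^t * (1/2)^L) ((1/2)^t * 2) := hasSum_geometric_two.mul_left _
    refine (tsum_of_norm_bounded hg2 ?_).trans (by linarith)
    intro L
    by_cases h : L.unpair.2.unpair.1 = t
    · have hLt : t ≤ L := by
        rw [← h]; exact (Nat.unpair_left_le _).trans (Nat.unpair_right_le _)
      calc ‖O L (b t)‖ ≤ ‖O L‖ * ‖b t‖ := (O L).le_opNorm _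
        _ = ‖O L‖ := by rw [b.orthonormal.1, mul_one]
        _ ≤ 1/4 * (1/4)^L := hO L
        _ ≤ (1/4)^L := by have : (0:ℝ) < (1/4)^L := by positivity
                          linarith
        _ = (1/2)^L * (1/2)^L := by rw [← mul_pow]; norm_num
        _ ≤ (1/2)^t * (1/2)^L := by
            have : (1/2:ℝ)^L ≤ (1/2)^t := pow_le_pow_of_le_one (by norm_num) (by norm_num) hLt
            gcongr
    · simp only [O, _root_.smul_apply, rankOne_apply, aux_inner_bb, if_neg h]
      simp
end

end

section
open Filter Topology InnerProductSpace

def colr (t : ℕ) : ℕ := t.unpair.1.unpair.1.unpair.1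
def swp (t : ℕ) : ℕ :=
  Nat.pair (Nat.pair (Nat.pair t.unpair.1.unpair.1.unpair.2 t.unpair.1.unpair.1.unpair.1) t.unpair.1.unpair.2)
    t.unpair.2

theorem swp_invol : Function.Involutive swp := by
  intro t; simp [swp]

theorem colr_lt (k : ℕ) (hk : 1 ≤ k) : colr k < k :=
  lt_of_le_of_lt ((Nat.unpair_left_le _).trans (Nat.unpair_left_le _)) (Nat.unpair_lt hk)

theorem aux_four {y p q r s a b c d : ℝ} (h : y = p - q - r + 2 * s) (hp : |p| ≤ a) (hq : |q| ≤ b)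
    (hr : |r| ≤ c) (hs : |s| ≤ d) : |y| ≤ a + b + c + 2 * d := by
  rw [abs_le] at *
  constructor <;> linarith

section
variable {H : Type} [NormedAddCommGroup H] [InnerProductSpace ℂ H] [CompleteSpace H]

set_option maxHeartbeats 4000000 in
theorem aux_V (b : HilbertBasis ℕ ℂ H) : ∃ (ε M : ℕ → ℝ) (V : H ≃ₗᵢ[ℂ] H) (h : ℕ → H),
    (∀ k, 0 < ε k) ∧ (∀ k, ε k ≤ 1) ∧ (∀ k, 0 ≤ M k) ∧ Monotone M ∧
    (∀ c c' x, IsBad b colr ε c x → IsBad b colr ε c' (V x) → x = 0) ∧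
    (Submodule.span ℂ (Set.range h)).topologicalClosure = ⊤ ∧
    (∀ κ, ∀ δ > 0, ∀ N, ∃ t ≥ N, 1 ≤ t ∧ colr t = 0 ∧ ∃ p q : ℂ, ‖p‖ ≤ M t ∧ ‖q‖ ≤ M t ∧
      ‖p • V.symm (b t) + q • b t - h κ‖ ≤ δ) := by
  obtain ⟨a, ρ, ha0, ha1, ha2, has, hρ, hρd⟩ := aux_seq
  obtain ⟨d, C, K, hd0, hd1, hC, hK, hKb, hKt⟩ := aux_K b a has
  let Kd := ContinuousLinearMap.adjoint K
  let S : H →L[ℂ] H := K - Kd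
  have hS : ‖S‖ < 1 := by
    have h1 : ‖S‖ ≤ ‖K‖ + ‖Kd‖ := norm_sub_le _ _
    have h2 : ‖Kd‖ = ‖K‖ := by simp [Kd]
    rw [h2] at h1; linarith
  have hskew : ContinuousLinearMap.adjoint S = -S := by simp [S, Kd]
  obtain ⟨E, F, W, hE, hF, hW⟩ := aux_cayley S hS hskew
  obtain ⟨B, hB⟩ := aux_perm b (Function.Involutive.toPerm swp swp_invol) (fun t => ρ t.unpair.2)
    (fun t => hρ _)
  simp only [Function.Involutive.coe_toPerm] at hB
  have hBi : ∀ t z, inner ℂ (b (swp t)) (B z) = ρ t.unpair.2 * inner ℂ (b t) z := by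
    intro t z
    have h1 := B.inner_map_map (b t) z
    rw [hB, inner_smul_left] at h1
    rw [← h1, ← mul_assoc, Complex.mul_conj, Complex.normSq_eq_norm_sq, hρ]; simp
  let ψ : ℕ → ℝ := fun t => d * (1/4)^t.unpair.1 * a t.unpair.2
  have hψ0 : ∀ t, 0 < ψ t := fun t => by have := ha0 t.unpair.2; positivity
  have hψa : ∀ t, ψ t ≤ a t.unpair.2 := by
    intro t
    have h1 : (1/4:ℝ)^t.unpair.1 ≤ 1 := pow_le_one₀ (by norm_num) (by norm_num)
    have h2 : d * (1/4:ℝ)^t.unpair.1 ≤ 1 := mul_le_one₀ hd1 (by positivity) h1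
    calc ψ t ≤ 1 * a t.unpair.2 := mul_le_mul_of_nonneg_right h2 (ha0 _).le
      _ = _ := one_mul _
  have hψ1 : ∀ t, ψ t ≤ 1 := fun t => (hψa t).trans (ha1 _)
  have hat : Tendsto a atTop (𝓝 0) := by
    have h1 := has.tendsto_atTop_zero
    have h2 := h1.sqrt
    simpa [Real.sqrt_sq (ha0 _).le] using h2
  have h2a : Tendsto (fun n => (1/2:ℝ)^n / a n) atTop (𝓝 0) := by
    have h1 : Tendsto (fun n : ℕ => (n:ℝ) * (1/2:ℝ)^n + (1/2:ℝ)^n) atTop (𝓝 (0 + 0)) :=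
      (tendsto_self_mul_const_pow_of_lt_one (by norm_num) (by norm_num)).add
        (tendsto_pow_atTop_nhds_zero_of_lt_one (by norm_num) (by norm_num))
    rw [add_zero] at h1
    refine squeeze_zero (fun n => by have := ha0 n; positivity) (fun n => ?_) h1
    have h3 := ha2 n
    rw [div_le_iff₀ (ha0 n)]
    have h4 : (0:ℝ) < (1/2)^n := by positivity
    have h5 : 1 ≤ ((n:ℝ)+1) * a n := by
      rw [div_le_iff₀ (by positivity)] at h3; linarith
    nlinarith
  have hKdb : ∀ t u, inner ℂ (b t) (Kd u) = inner ℂ (K (b t)) u := by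
    intro t u; simp only [Kd]; rw [ContinuousLinearMap.adjoint_inner_right]
  refine ⟨fun t => ψ t * ψ (swp t), fun t => ∑ t' ∈ Finset.range (t+1), 1 / ψ t', W.trans B,
    fun κ => F.symm (b κ), fun t => mul_pos (hψ0 _) (hψ0 _), fun t => ?_, fun t => ?_, ?_, ?_, ?_, ?_⟩
  · exact mul_le_one₀ (hψ1 _) (hψ0 _).le (hψ1 _)
  · exact Finset.sum_nonneg fun t' _ => (one_div_pos.mpr (hψ0 t')).le
  · intro s t hst
    exact Finset.sum_le_sum_of_subset_of_nonneg (Finset.range_mono (by omega))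
      fun t' _ _ => (one_div_pos.mpr (hψ0 t')).le
  · rintro c c' x ⟨α, hα, n0, hx⟩ ⟨β, hβ, n1, hVx⟩
    obtain ⟨u, rfl⟩ := E.surjective x
    have hmain : ∀ κ f, ((starRingEnd ℂ) α * (Complex.I ^ f * inner ℂ (b κ) u)).im = 0 := by
      intro κ f
      set J := ((starRingEnd ℂ) α * (Complex.I ^ f * inner ℂ (b κ) u)).im with hJ
      set L := Nat.pair (Nat.pair c c') (Nat.pair κ f) with hL
      set D := d * (1/4)^L with hD
      have hD0 : 0 < D := by positivity
      have hD1 : D ≤ 1 := by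
        have h1 : (1/4:ℝ)^L ≤ 1 := pow_le_one₀ (by norm_num) (by norm_num)
        exact mul_le_one₀ hd1 (by positivity) h1
      suffices hs : ∀ e > 0, D * |J| ≤ e by
        have h1 : D * |J| ≤ 0 := le_of_forall_pos_le_add (by simpa using hs)
        have h2 : |J| ≤ 0 := by
          by_contra h; push Not at h
          have := mul_pos hD0 h; linarith
        exact abs_nonpos_iff.mp h2
      intro e he
      have hl1 := hat.eventually_le_const (show (0:ℝ) < e/3 by linarith)
      have hl2 := (h2a.mul_const (C * ‖u‖)).eventually_le_const (show 0 * (C * ‖u‖) < e/3 by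
        rw [zero_mul]; linarith)
      obtain ⟨N, hN⟩ := eventually_atTop.mp (hl1.and hl2)
      obtain ⟨n, hn, hρn⟩ := hρd (β * (starRingEnd ℂ) α) (by rw [norm_mul, RCLike.norm_conj, hα, hβ, one_mul])
        (e/3/(‖E u‖+1)) (by positivity) (max (max n0 n1) N)
      obtain ⟨hN1, hN2⟩ := hN n (le_trans (le_max_right _ _) hn)
      set t := Nat.pair L n with ht
      have ht1 : t.unpair.1 = L := by simp [ht]
      have ht2 : t.unpair.2 = n := by simp [ht]
      have htn : n ≤ t := Nat.right_le_pair _ _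
      have hc : colr t = c := by simp [colr, ht, hL]
      have hc' : colr (swp t) = c' := by simp [colr, swp, ht, hL]
      have hst : n ≤ swp t := by
        rw [swp, ht2]; exact Nat.right_le_pair _ _
      have hnn : n0 ≤ n := le_trans (le_trans (le_max_left _ _) (le_max_left _ _)) hn
      have hnn1 : n1 ≤ n := le_trans (le_trans (le_max_right _ _) (le_max_left _ _)) hn
      have q1 := hx t (by omega) hc
      have q2 := hVx (swp t) (by omega) hc'
      have hψt : ψ t = D * a n := by simp only [ψ, ht1, ht2, hD]
      have hψs : ψ (swp t) ≤ a n := by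
        have := hψa (swp t)
        simpa [swp, ht2] using this
      beta_reduce at q1 q2
      rw [swp_invol t] at q2
      rw [LinearIsometryEquiv.trans_apply, hW, hBi, ht2] at q2
      have hv : inner ℂ (b t) (S u) = (D * a n : ℝ) * (Complex.I ^ f * inner ℂ (b κ) u) - inner ℂ (K (b t)) u := by
        have e1 : S u = K u - Kd u := rfl
        rw [e1, inner_sub_right, hKdb, hKb, ht1, ht2]
        simp only [hL, Nat.unpair_pair]
        rw [← hL, ← hD]; push_cast; ring
      rw [hE, inner_sub_right] at q1
      have hFn : ‖inner ℂ (b t) (F u)‖ ≤ ‖E u‖ := by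
        have := aux_coord_le b (F u) t
        rw [← hW, W.norm_map] at this
        rwa [← hW]
      -- combine
      have hη : ‖(starRingEnd ℂ) β * ρ n - (starRingEnd ℂ) α‖ ≤ e/3/(‖E u‖+1) * a n := by
        have h1 : (starRingEnd ℂ) β * ρ n - (starRingEnd ℂ) α
            = (starRingEnd ℂ) β * (ρ n - β * (starRingEnd ℂ) α) := by
          have : (starRingEnd ℂ) β * β = 1 := by
            rw [mul_comm, Complex.mul_conj, Complex.normSq_eq_norm_sq, hβ]; simp
          rw [mul_sub, ← mul_assoc, this, one_mul]
        rw [h1, norm_mul, RCLike.norm_conj, hβ, one_mul]; exact hρn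
      have hz1 : |(((starRingEnd ℂ) β * ρ n - (starRingEnd ℂ) α) * inner ℂ (b t) (F u)).im| ≤ e/3 * a n := by
        refine (Complex.abs_im_le_norm _).trans ?_
        rw [norm_mul]
        have := ha0 n
        calc _ ≤ e/3/(‖E u‖+1) * a n * (‖E u‖ + 1) := by
              gcongr
              linarith
          _ = _ := by field_simp
      have hz2 : |((starRingEnd ℂ) α * inner ℂ (K (b t)) u).im| ≤ C * (1/2)^n * ‖u‖ := by
        refine (Complex.abs_im_le_norm _).trans ?_
        rw [norm_mul, RCLike.norm_conj, hα, one_mul]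
        refine (norm_inner_le_norm _ _).trans ?_
        gcongr
        refine (hKt t).trans ?_
        have : (1/2:ℝ)^t ≤ (1/2)^n := pow_le_pow_of_le_one (by norm_num) (by norm_num) htn
        gcongr
      rw [hF, inner_add_right] at q2 hz1
      have hid : 2 * (D * a n * J) = ((starRingEnd ℂ) β * (ρ n * (inner ℂ (b t) u + inner ℂ (b t) (S u)))).im
          - (((starRingEnd ℂ) β * ρ n - (starRingEnd ℂ) α) * (inner ℂ (b t) u + inner ℂ (b t) (S u))).im
          - ((starRingEnd ℂ) α * (inner ℂ (b t) u - inner ℂ (b t) (S u))).im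
          + 2 * ((starRingEnd ℂ) α * inner ℂ (K (b t)) u).im := by
        have h1 : (starRingEnd ℂ) β * (ρ n * (inner ℂ (b t) u + inner ℂ (b t) (S u)))
          - ((starRingEnd ℂ) β * ρ n - (starRingEnd ℂ) α) * (inner ℂ (b t) u + inner ℂ (b t) (S u))
          - (starRingEnd ℂ) α * (inner ℂ (b t) u - inner ℂ (b t) (S u))
          = 2 * ((D * a n : ℝ) * ((starRingEnd ℂ) α * (Complex.I ^ f * inner ℂ (b κ) u))
            - (starRingEnd ℂ) α * inner ℂ (K (b t)) u) := by
          rw [hv]; ring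
        have h2 := congrArg Complex.im h1
        have h2' : (2:ℂ) = ((2:ℝ):ℂ) := by norm_num
        rw [h2', Complex.im_ofReal_mul, Complex.sub_im, Complex.sub_im, Complex.sub_im, Complex.im_ofReal_mul] at h2
        rw [← hJ] at h2
        linarith
      have hψψ : ψ t * ψ (swp t) ≤ D * a n * (e/3) := by
        rw [hψt]
        have := ha0 n
        have h3 : ψ (swp t) ≤ e/3 := hψs.trans hN1
        gcongr
      have hz3 : C * (1/2)^n * ‖u‖ ≤ e/3 * a n := by
        rw [div_mul_eq_mul_div, div_le_iff₀ (ha0 n)] at hN2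
        linarith
      have hz4 : D * a n * (e/3) ≤ e/3 * a n := by
        have := ha0 n
        have h3 : 0 ≤ a n * (e/3) := by positivity
        nlinarith
      have hfin : D * a n * |J| ≤ e * a n := by
        have h5 : |2 * (D * a n * J)| = 2 * (D * a n * |J|) := by
          rw [abs_mul, abs_mul, abs_of_pos (mul_pos hD0 (ha0 n)), abs_two]
        have h6 := aux_four hid q2 hz1 q1 hz2
        rw [h5] at h6
        have hpos : 0 < e * a n := mul_pos he (ha0 n)
        have h8 : ψ (swp t) * ψ t = ψ t * ψ (swp t) := mul_comm _ _
        linarith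
      have := ha0 n
      have h7 : (D * |J|) * a n ≤ e * a n := by linarith
      exact le_of_mul_le_mul_right h7 this
    have hu : u = 0 := by
      apply aux_ext b
      intro κ
      have h0 := hmain κ 0
      have h1 := hmain κ 1
      rw [pow_zero, one_mul] at h0
      rw [pow_one, mul_left_comm, Complex.I_mul_im] at h1
      have h2 : (starRingEnd ℂ) α * inner ℂ (b κ) u = 0 := Complex.ext h1 h0
      rcases mul_eq_zero.mp h2 with h3 | h3
      · have := congrArg norm h3
        rw [RCLike.norm_conj, hα] at this; simp at this
      · exact h3
    rw [hu]; simp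
  · have h1 : (Set.range fun κ => F.symm (b κ)) = F.symm '' Set.range b := by
      rw [← Set.range_comp]; rfl
    have hd' : Dense (Submodule.span ℂ (Set.range b) : Set H) :=
      Submodule.dense_iff_topologicalClosure_eq_top.mpr b.dense_span
    rw [← Submodule.dense_iff_topologicalClosure_eq_top, h1]
    have h2 : (Submodule.span ℂ (F.symm '' Set.range b) : Set H) = F.symm '' (Submodule.span ℂ (Set.range b) : Set H) := by
      have := Submodule.span_image (F.symm.toLinearEquiv.toLinearMap) (s := Set.range b)
      have h3 := congrArg (fun s : Submodule ℂ H => (s : Set H)) this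
      simpa using h3
    rw [h2]
    exact F.symm.surjective.denseRange.dense_image F.symm.continuous hd'
  · intro κ δ hδ N
    set L := Nat.pair (Nat.pair 0 0) (Nat.pair κ 0) with hL
    set D := d * (1/4)^L with hD
    have hD0 : 0 < D := by positivity
    have hl := (h2a.mul_const (‖(F.symm : H →L[ℂ] H)‖ * C / D)).eventually_le_const
      (show 0 * (‖(F.symm : H →L[ℂ] H)‖ * C / D) < δ by rw [zero_mul]; exact hδ)
    obtain ⟨n, hn1, hn2⟩ := (hl.and (eventually_ge_atTop (N+1))).exists
    set t := Nat.pair L n with ht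
    have ht1 : t.unpair.1 = L := by simp [ht]
    have ht2 : t.unpair.2 = n := by simp [ht]
    have htn : n ≤ t := Nat.right_le_pair _ _
    have hst : swp t = t := by simp [swp, ht, hL]
    have hψt : ψ t = D * a n := by simp only [ψ, ht1, ht2, hD]
    have hM : 1 / ψ t ≤ ∑ t' ∈ Finset.range (t+1), 1 / ψ t' :=
      Finset.single_le_sum (f := fun t' => 1 / ψ t') (fun t' _ => (one_div_pos.mpr (hψ0 t')).le)
        (Finset.mem_range.mpr (Nat.lt_succ_self t))
    have hψp := hψ0 t
    have hn2' : ‖(1 / (2 * ψ t) : ℂ)‖ ≤ 1 / ψ t := by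
      rw [norm_div, norm_mul, Complex.norm_real, Real.norm_of_nonneg hψp.le]
      simp only [norm_one, Complex.norm_ofNat]
      apply one_div_le_one_div_of_le hψp; linarith
    refine ⟨t, by omega, by omega, by simp [colr, ht, hL], ρ n * (1 / (2 * ψ t)), -(1 / (2 * ψ t)),
      ?_, ?_, ?_⟩
    · rw [norm_mul, hρ, one_mul]; exact hn2'.trans hM
    · rw [norm_neg]; exact hn2'.trans hM
    · have hKd : Kd (b t) = (ψ t : ℂ) • b κ := by
        rw [← sub_eq_zero]
        apply ext_inner_right ℂ
        intro u
        rw [inner_sub_left, inner_smul_left, ContinuousLinearMap.adjoint_inner_left, hKb, ht1, ht2, hψt]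
        simp only [hL, Nat.unpair_pair]
        rw [← hL, ← hD]; simp
      have hV : ρ n • (W.trans B).symm (b t) = W.symm (b t) := by
        have h1 : (W.trans B).symm (b t) = W.symm (B.symm (b t)) := rfl
        rw [h1, ← map_smul, ← map_smul]
        congr 1
        rw [LinearIsometryEquiv.symm_apply_eq, hB, hst, ht2]
      set w := F.symm (b t) with hw
      have hFw : w + S w = b t := by rw [← hF, hw, F.apply_symm_apply]
      have hWs : W.symm (b t) = w - S w := by
        rw [LinearIsometryEquiv.symm_apply_eq, ← hE, hW, hF, hFw]
      have hSw : S w = F.symm (K (b t)) - (ψ t : ℂ) • F.symm (b κ) := by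
        apply F.injective
        rw [map_sub, map_smul, F.apply_symm_apply, F.apply_symm_apply, hF, ← map_add, hFw, ← hKd]; rfl
      have hfin : (ρ n * (1 / (2 * ψ t))) • (W.trans B).symm (b t) + (-(1 / (2 * ψ t)) : ℂ) • b t - F.symm (b κ)
          = (-(1 / ψ t) : ℂ) • F.symm (K (b t)) := by
        rw [mul_comm, mul_smul, hV, hWs]
        nth_rewrite 1 [← hFw]
        rw [hSw]
        have : (ψ t : ℂ) ≠ 0 := by exact_mod_cast hψp.ne'
        have h9 : (1 / (2 * ψ t) : ℂ) * (2 * ψ t) = 1 := by field_simp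
        have h10 : (1 / ψ t : ℂ) = 2 * (1 / (2 * ψ t)) := by field_simp
        rw [h10]
        generalize (1 / (2 * ψ t) : ℂ) = y at *
        generalize F.symm (b κ) = hh at *
        linear_combination (norm := module) h9 • hh
      rw [hfin, norm_smul, norm_neg, norm_div, norm_one, Complex.norm_real, Real.norm_of_nonneg hψp.le]
      have h12 : ‖F.symm (K (b t))‖ ≤ ‖(F.symm : H →L[ℂ] H)‖ * (C * (1/2)^n) := by
        refine ((F.symm : H →L[ℂ] H).le_opNorm _).trans ?_
        gcongr
        refine (hKt t).trans ?_
        have : (1/2:ℝ)^t ≤ (1/2)^n := pow_le_pow_of_le_one (by norm_num) (by norm_num) htn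
        gcongr
      refine le_trans ?_ hn1
      have := ha0 n
      calc 1 / ψ t * ‖F.symm (K (b t))‖ ≤ 1 / ψ t * (‖(F.symm : H →L[ℂ] H)‖ * (C * (1/2)^n)) := by gcongr
        _ = _ := by rw [hψt]; field_simp
end

end

section
open Filter Topology InnerProductSpace

section
variable {H : Type} [NormedAddCommGroup H] [InnerProductSpace ℂ H] [CompleteSpace H]

theorem aux_compact (b : HilbertBasis ℕ ℂ H) (A : Subalgebra ℂ (H →L[ℂ] H))
    (hA : IsClosed (A : Set (H →L[ℂ] H))) (hr : ∀ y φ : H, rankOne ℂ y φ ∈ A)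
    (K : H →L[ℂ] H) (hK : IsCompactOperator K) : K ∈ A := by
  let P : ℕ → H →L[ℂ] H := fun n => ∑ k ∈ Finset.range n, rankOne ℂ (b k) (b k)
  have hPa : ∀ n z, P n z = ∑ k ∈ Finset.range n, inner ℂ (b k) z • b k := by
    intro n z
    simp [P, ContinuousLinearMap.sum_apply]
  have hPn : ∀ n z, ‖P n z‖ ≤ ‖z‖ := by
    intro n z
    have h1 := b.orthonormal.sum_inner_products_le z (s := Finset.range n)
    have h2 : ((‖P n z‖^2 : ℝ) : ℂ) = ((∑ k ∈ Finset.range n, ‖inner ℂ (b k) z‖^2 : ℝ) : ℂ) := by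
      push_cast
      have h0 : ((‖P n z‖ : ℝ) : ℂ) ^ 2 = inner ℂ (P n z) (P n z) :=
        (inner_self_eq_norm_sq_to_K (𝕜 := ℂ) (P n z)).symm
      rw [h0, hPa, b.orthonormal.inner_sum]
      apply Finset.sum_congr rfl
      intro k _
      rw [mul_comm, Complex.mul_conj, Complex.normSq_eq_norm_sq]; push_cast; rfl
    have h3 : ‖P n z‖^2 = ∑ k ∈ Finset.range n, ‖inner ℂ (b k) z‖^2 := by exact_mod_cast h2
    rw [← h3] at h1
    exact (pow_le_pow_iff_left₀ (norm_nonneg _) (norm_nonneg _) (by norm_num)).mp h1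
  have hPt : ∀ z, Tendsto (fun n => P n z) atTop (𝓝 z) := by
    intro z
    have := (aux_coord b z).tendsto_sum_nat
    simpa only [hPa] using this
  have hPK : ∀ n, P n ∘L K ∈ A := by
    intro n
    have : P n ∘L K = ∑ k ∈ Finset.range n, rankOne ℂ (b k) (ContinuousLinearMap.adjoint K (b k)) := by
      ext z
      simp only [ContinuousLinearMap.comp_apply, hPa, ContinuousLinearMap.sum_apply, rankOne_apply,
        ContinuousLinearMap.adjoint_inner_left]
    rw [this]
    exact Subalgebra.sum_mem _ fun k _ => hr _ _
  have hmem : K ∈ closure (A : Set (H →L[ℂ] H)) := by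
    rw [Metric.mem_closure_iff]
    intro e he
    have hc := hK.isCompact_closure_image_closedBall 1
    obtain ⟨F, hFs, hF, hcov⟩ := hc.finite_cover_balls (show (0:ℝ) < e/4 by linarith)
    have hev : ∀ᶠ n in atTop, ∀ y ∈ F, ‖P n y - y‖ ≤ e/4 := by
      rw [Set.Finite.eventually_all hF]
      intro y _
      have h1 : Tendsto (fun n => ‖P n y - y‖) atTop (𝓝 0) := by
        have := ((hPt y).sub_const y).norm
        simpa using this
      exact h1.eventually_le_const (by linarith)
    obtain ⟨n, hn⟩ := hev.exists
    refine ⟨P n ∘L K, hPK n, ?_⟩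
    rw [dist_comm, dist_eq_norm]
    refine lt_of_le_of_lt (b := 3 * e/4) ?_ (by linarith)
    refine ContinuousLinearMap.opNorm_le_of_unit_norm (𝕜 := ℂ) (by linarith) ?_
    intro x hx
    have hx1 : K x ∈ closure (K '' Metric.closedBall 0 1) :=
      subset_closure ⟨x, by simp [hx], rfl⟩
    obtain ⟨y, hy, hxy⟩ := Set.mem_iUnion₂.mp (hcov hx1)
    rw [Metric.mem_ball, dist_eq_norm] at hxy
    have h2 : (P n ∘L K - K) x = P n (K x - y) + (P n y - y) - (K x - y) := by
      simp only [_root_.sub_apply, ContinuousLinearMap.comp_apply, map_sub]; abel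
    rw [h2]
    have h3 := hPn n (K x - y)
    have h4 := hn y hy
    refine (norm_sub_le _ _).trans ?_
    have h5 := norm_add_le (P n (K x - y)) (P n y - y)
    linarith
  rwa [hA.closure_eq] at hmem

theorem aux_alg (b : HilbertBasis ℕ ℂ H) (T T' : H →L[ℂ] H) (V : H ≃ₗᵢ[ℂ] H) (R M : ℕ → ℝ) (h : ℕ → H)
    (i s : ℕ → ℕ) (hR : ∀ k, 1 ≤ R k) (hM : ∀ k, 0 ≤ M k) (hMm : Monotone M)
    (hT' : ∀ x, T' x = V.symm (T (V x)))
    (hTm : ∀ k, 1 ≤ k → i k = 0 →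
      ∃ m, ∀ x, ‖(T ^ m) x - x + (2 * R k * inner ℂ (b k) x) • b 0‖ ≤ 3 * ‖x‖)
    (hden : Dense (Set.range fun n : ℕ => (T ^ n) (V (b 0))))
    (hh : (Submodule.span ℂ (Set.range h)).topologicalClosure = ⊤)
    (hV : ∀ κ, ∀ δ > 0, ∀ N, ∃ t ≥ N, 1 ≤ t ∧ i t = 0 ∧ ∃ p q : ℂ, ‖p‖ ≤ M t ∧ ‖q‖ ≤ M t ∧
      ‖p • V.symm (b t) + q • b t - h κ‖ ≤ δ)
    (hs : ∀ k, k ≤ s k ∧ 1 ≤ s k ∧ i (s k) = 0 ∧ inner ℂ (b (s k)) (V.symm (b 0)) ≠ 0)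
    (hR1 : ∀ k : ℕ, k * M k ≤ R k)
    (hR2 : ∀ k : ℕ, inner ℂ (b k) (V.symm (b 0)) ≠ 0 → k * M k / ‖inner ℂ (b k) (V.symm (b 0))‖ ≤ R k)
    (hR3 : ∀ k : ℕ, k * M k / ‖inner ℂ (b (s k)) (V.symm (b 0))‖ ≤ R k)
    (A : Subalgebra ℂ (H →L[ℂ] H)) (hA : IsClosed (A : Set (H →L[ℂ] H))) (hTA : T ∈ A) (hTA' : T' ∈ A) :
    ∀ y φ : H, rankOne ℂ y φ ∈ A := by
  have hRpos : ∀ k, 0 < R k := fun k => lt_of_lt_of_le one_pos (hR k)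
  have hT'n : ∀ n x, (T' ^ n) x = V.symm ((T ^ n) (V x)) := by
    intro n x
    induction n generalizing x with
    | zero => simp
    | succ n ih => rw [pow_succ, mul_apply_eq_comp, ih, hT', pow_succ, mul_apply_eq_comp]; simp
  have hAk : ∀ k, 1 ≤ k → i k = 0 → ∃ X ∈ A, ‖X - rankOne ℂ (b 0) (b k)‖ ≤ 2 / R k := by
    intro k hk hik
    obtain ⟨m, hm⟩ := hTm k hk hik
    refine ⟨(-(1 / (2 * R k)) : ℂ) • (T ^ m - 1), A.smul_mem (A.sub_mem (A.pow_mem hTA m) A.one_mem) _, ?_⟩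
    have hr := hRpos k
    apply ContinuousLinearMap.opNorm_le_bound _ (by positivity)
    intro x
    have hne : (R k : ℂ) ≠ 0 := by exact_mod_cast hr.ne'
    have e1 : ((-(1 / (2 * R k)) : ℂ) • (T ^ m - 1) - rankOne ℂ (b 0) (b k)) x
        = (-(1 / (2 * R k)) : ℂ) • ((T ^ m) x - x + (2 * R k * inner ℂ (b k) x) • b 0) := by
      simp only [_root_.sub_apply, _root_.smul_apply, rankOne_apply, ContinuousLinearMap.one_apply]
      rw [smul_add, smul_smul, ← sub_neg_eq_add, ← neg_smul]
      congr 2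
      field_simp
    rw [e1, norm_smul, norm_neg, norm_div, norm_one, norm_mul, Complex.norm_real, Real.norm_of_nonneg hr.le,
      Complex.norm_ofNat]
    calc 1 / (2 * R k) * _ ≤ 1 / (2 * R k) * (3 * ‖x‖) := by gcongr; exact hm x
      _ = (3/2) * (‖x‖ / R k) := by field_simp
      _ ≤ 2 * (‖x‖ / R k) := by gcongr; norm_num
      _ = _ := by ring
  have hAk' : ∀ k, 1 ≤ k → i k = 0 → ∃ X ∈ A, ‖X - rankOne ℂ (V.symm (b 0)) (V.symm (b k))‖ ≤ 2 / R k := by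
    intro k hk hik
    obtain ⟨m, hm⟩ := hTm k hk hik
    refine ⟨(-(1 / (2 * R k)) : ℂ) • (T' ^ m - 1), A.smul_mem (A.sub_mem (A.pow_mem hTA' m) A.one_mem) _, ?_⟩
    have hr := hRpos k
    apply ContinuousLinearMap.opNorm_le_bound _ (by positivity)
    intro x
    have hne : (R k : ℂ) ≠ 0 := by exact_mod_cast hr.ne'
    have hin : inner ℂ (V.symm (b k)) x = inner ℂ (b k) (V x) := by
      rw [← V.inner_map_map, V.apply_symm_apply]
    have e1 : ((-(1 / (2 * R k)) : ℂ) • (T' ^ m - 1) - rankOne ℂ (V.symm (b 0)) (V.symm (b k))) x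
        = (-(1 / (2 * R k)) : ℂ) • V.symm ((T ^ m) (V x) - V x + (2 * R k * inner ℂ (b k) (V x)) • b 0) := by
      simp only [_root_.sub_apply, _root_.smul_apply, rankOne_apply, ContinuousLinearMap.one_apply, hT'n, hin,
        map_add, map_sub, map_smul, V.symm_apply_apply]
      rw [smul_add, smul_smul, ← sub_neg_eq_add, ← neg_smul]
      congr 2
      field_simp
    rw [e1, norm_smul, norm_neg, norm_div, norm_one, norm_mul, Complex.norm_real, Real.norm_of_nonneg hr.le,
      Complex.norm_ofNat, LinearIsometryEquiv.norm_map]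
    have hmv := hm (V x)
    rw [V.norm_map] at hmv
    calc 1 / (2 * R k) * _ ≤ 1 / (2 * R k) * (3 * ‖x‖) := by gcongr
      _ = (3/2) * (‖x‖ / R k) := by field_simp
      _ ≤ 2 * (‖x‖ / R k) := by gcongr; norm_num
      _ = _ := by ring
  have hb1 : ∀ k, ‖b k‖ = 1 := b.orthonormal.1
  have hκ : ∀ κ, rankOne ℂ (b 0) (h κ) ∈ A := by
    intro κ
    suffices hm : rankOne ℂ (b 0) (h κ) ∈ closure (A : Set (H →L[ℂ] H)) by rwa [hA.closure_eq] at hm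
    rw [Metric.mem_closure_iff]
    intro e he
    obtain ⟨N, hN⟩ := exists_nat_gt (20 / e)
    obtain ⟨t, htN, ht1, hit, p, q, hp, hq, hpq⟩ := hV κ (e/3) (by linarith) N
    obtain ⟨hst, hs1, his, hη⟩ := hs t
    obtain ⟨X, hXA, hX⟩ := hAk t ht1 hit
    obtain ⟨Y, hYA, hY⟩ := hAk (s t) hs1 his
    obtain ⟨Z, hZA, hZ⟩ := hAk' t ht1 hit
    set η := inner ℂ (b (s t)) (V.symm (b 0)) with hηd
    have hη0 : 0 < ‖η‖ := norm_pos_iff.mpr hη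
    refine ⟨((starRingEnd ℂ) p * η⁻¹) • (Y * Z) + (starRingEnd ℂ) q • X,
      A.add_mem (A.smul_mem (A.mul_mem hYA hZA) _) (A.smul_mem hXA _), ?_⟩
    rw [dist_comm, dist_eq_norm]
    set Y0 := rankOne ℂ (b 0) (b (s t)) with hY0
    set Z0 := rankOne ℂ (V.symm (b 0)) (V.symm (b t)) with hZ0
    set X0 := rankOne ℂ (b 0) (b t) with hX0
    have hYZ : Y0 * Z0 = η • rankOne ℂ (b 0) (V.symm (b t)) := by
      ext x
      simp only [hY0, hZ0, mul_apply_eq_comp, rankOne_apply, inner_smul_right, _root_.smul_apply, smul_smul]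
      rw [mul_comm]
    have hid : ((starRingEnd ℂ) p * η⁻¹) • (Y * Z) + (starRingEnd ℂ) q • X - rankOne ℂ (b 0) (h κ)
        = ((starRingEnd ℂ) p * η⁻¹) • (Y * Z - Y0 * Z0) + (starRingEnd ℂ) q • (X - X0)
          + rankOne ℂ (b 0) (p • V.symm (b t) + q • b t - h κ) := by
      rw [smul_sub _ (Y * Z), hYZ, smul_smul, mul_assoc, inv_mul_cancel₀ hη, mul_one]
      rw [map_sub, map_add, map_smulₛₗ, map_smulₛₗ]
      rw [smul_sub]
      abel
    rw [hid]
    have hN0 : 0 < (t:ℝ) := by exact_mod_cast ht1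
    have hZ0n : ‖Z0‖ = 1 := by rw [hZ0, norm_rankOne, LinearIsometryEquiv.norm_map, LinearIsometryEquiv.norm_map, hb1, hb1, one_mul]
    have hY0n : ‖Y0‖ = 1 := by rw [hY0, norm_rankOne, hb1, hb1, one_mul]
    have hrt := hRpos t
    have hrs := hRpos (s t)
    have hZn : ‖Z‖ ≤ 3 := by
      have h1 : ‖Z‖ ≤ ‖Z - Z0‖ + ‖Z0‖ := by
        have := norm_add_le (Z - Z0) Z0
        rwa [sub_add_cancel] at this
      have h2 : 2 / R t ≤ 2 := by rw [div_le_iff₀ hrt]; linarith [hR t]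
      linarith
    have hprod : ‖Y * Z - Y0 * Z0‖ ≤ 2 / R (s t) * 3 + 2 / R t := by
      have h1 : Y * Z - Y0 * Z0 = (Y - Y0) * Z + Y0 * (Z - Z0) := by noncomm_ring
      rw [h1]
      refine (norm_add_le _ _).trans ?_
      refine add_le_add ((norm_mul_le _ _).trans ?_) ((norm_mul_le _ _).trans ?_)
      · gcongr
      · rw [hY0n, one_mul]; exact hZ
    have hMt := hM t
    have r1 : M t / ‖η‖ / R (s t) ≤ 1 / t := by
      have h1 := hR2 (s t) hη
      rw [← hηd] at h1
      rw [div_le_div_iff₀ hrs hN0, one_mul]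
      refine le_trans ?_ h1
      rw [div_mul_eq_mul_div, mul_comm]
      have h2 : (t:ℝ) ≤ s t := by exact_mod_cast hst
      have h3 : M t ≤ M (s t) := hMm hst
      gcongr
    have r2 : M t / ‖η‖ / R t ≤ 1 / t := by
      have h1 := hR3 t
      rw [← hηd] at h1
      rw [div_le_div_iff₀ hrt hN0, one_mul]
      refine le_trans (le_of_eq ?_) h1
      ring
    have r3 : M t / R t ≤ 1 / t := by
      rw [div_le_div_iff₀ hrt hN0, one_mul]
      have := hR1 t
      linarith
    have n1 : ‖((starRingEnd ℂ) p * η⁻¹) • (Y * Z - Y0 * Z0)‖ ≤ 8 * (1 / t) := by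
      rw [norm_smul, norm_mul, RCLike.norm_conj, norm_inv]
      calc _ ≤ M t * ‖η‖⁻¹ * (2 / R (s t) * 3 + 2 / R t) := by gcongr
        _ = 6 * (M t / ‖η‖ / R (s t)) + 2 * (M t / ‖η‖ / R t) := by ring
        _ ≤ _ := by linarith
    have n2 : ‖(starRingEnd ℂ) q • (X - X0)‖ ≤ 2 * (1 / t) := by
      rw [norm_smul, RCLike.norm_conj]
      calc _ ≤ M t * (2 / R t) := by gcongr
        _ = 2 * (M t / R t) := by ring
        _ ≤ _ := by linarith
    have n3 : ‖rankOne ℂ (b 0) (p • V.symm (b t) + q • b t - h κ)‖ ≤ e/3 := by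
      rw [norm_rankOne, hb1, one_mul]; exact hpq
    have n4 : 1 / (t:ℝ) ≤ e / 20 := by
      have h1 : 20 / e < t := lt_of_lt_of_le hN (by exact_mod_cast htN)
      rw [div_lt_iff₀ he] at h1
      rw [div_le_div_iff₀ hN0 (by norm_num)]; linarith
    refine lt_of_le_of_lt norm_add₃_le ?_
    linarith
  have hφ : ∀ φ, rankOne ℂ (b 0) φ ∈ A := by
    have hsp : ∀ φ ∈ Submodule.span ℂ (Set.range h), rankOne ℂ (b 0) φ ∈ A := by
      intro φ hφ
      induction hφ using Submodule.span_induction with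
      | mem y hy => obtain ⟨κ, rfl⟩ := hy; exact hκ κ
      | zero => rw [map_zero]; exact A.zero_mem
      | add v w _ _ hv hw => rw [map_add]; exact A.add_mem hv hw
      | smul a v _ hv => rw [map_smulₛₗ]; exact A.smul_mem hv _
    intro φ
    have hd : Dense (Submodule.span ℂ (Set.range h) : Set H) :=
      Submodule.dense_iff_topologicalClosure_eq_top.mpr hh
    have hmt : Set.MapsTo (fun φ => rankOne ℂ (b 0) φ) (Submodule.span ℂ (Set.range h) : Set H) (A : Set _) := hsp
    have := hmt.closure (rankOne ℂ (b 0)).continuous (hd φ)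
    rwa [hA.closure_eq] at this
  intro y φ
  have hd : Dense (Set.range fun n : ℕ => (T' ^ n) (b 0)) := by
    have h1 : (Set.range fun n : ℕ => (T' ^ n) (b 0)) = V.symm '' (Set.range fun n : ℕ => (T ^ n) (V (b 0))) := by
      rw [← Set.range_comp]; congr 1; ext n; rw [hT'n]; rfl
    rw [h1]
    exact V.symm.surjective.denseRange.dense_image V.symm.continuous hden
  have hmt : Set.MapsTo (fun y => rankOne ℂ y φ) (Set.range fun n : ℕ => (T' ^ n) (b 0)) (A : Set _) := by
    rintro _ ⟨n, rfl⟩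
    have : rankOne ℂ ((T' ^ n) (b 0)) φ = T' ^ n * rankOne ℂ (b 0) φ := by
      ext x; simp [mul_apply_eq_comp]
    show rankOne ℂ ((T' ^ n) (b 0)) φ ∈ A
    rw [this]
    exact A.mul_mem (A.pow_mem hTA' n) (hφ φ)
  have hcont : Continuous (fun y : H => rankOne ℂ y φ) := by fun_prop
  have := hmt.closure hcont (hd y)
  rwa [hA.closure_eq] at this
end

end

/-- There exist a bounded operator `T` and a unitary `V` on a complex separable
infinite-dimensional Hilbert space `H` such that (i) for every non-zero `x ∈ H`, either `x` or
`V x` is hypercyclic for `T`, and (ii) the operator-norm closure of the subalgebra of `B(H)`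
generated by `T` and `V⁻¹ T V` contains every compact operator on `H`. -/
theorem stmt_15 (H : Type) [NormedAddCommGroup H] [InnerProductSpace ℂ H] [CompleteSpace H]
    [TopologicalSpace.SeparableSpace H] (hdim : ¬ FiniteDimensional ℂ H) :
    ∃ (T : H →L[ℂ] H) (V : H ≃ₗᵢ[ℂ] H),
      (∀ x : H, x ≠ 0 →
        Dense (Set.range fun n : ℕ => (T ^ n) x) ∨
        Dense (Set.range fun n : ℕ => (T ^ n) (V x))) ∧
      ∀ K : H →L[ℂ] H, IsCompactOperator K →
        K ∈ closure (Algebra.adjoin ℂ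
          {T, (V.symm.toContinuousLinearEquiv : H →L[ℂ] H).comp
            (T.comp (V.toContinuousLinearEquiv : H →L[ℂ] H))} : Set (H →L[ℂ] H)) := by
  obtain ⟨b⟩ := aux_basis H hdim
  obtain ⟨ε, M, V, h, hε0, hε1, hM, hMm, hbad, hh, hV⟩ := aux_V b
  have hb0 : b 0 ≠ 0 := b.orthonormal.ne_zero 0
  have hex : ∀ N, ∃ s, N ≤ s ∧ colr s = 0 ∧ inner ℂ (b s) (V.symm (b 0)) ≠ 0 := by
    intro N
    by_contra hcon
    push Not at hcon
    have h1 : IsBad b colr ε 0 (V.symm (b 0)) := by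
      refine ⟨1, by simp, N, ?_⟩
      intro k hk hc
      rw [hcon k hk hc]
      simpa using (hε0 k).le
    have h2 : IsBad b colr ε 0 (V (V.symm (b 0))) := by
      refine ⟨1, by simp, 1, ?_⟩
      intro k hk hc
      rw [V.apply_symm_apply, aux_inner_bb, if_neg (by omega)]
      simpa using (hε0 k).le
    have h3 := hbad 0 0 _ h1 h2
    exact hb0 (by simpa using h3)
  have hs' : ∀ k : ℕ, ∃ s, k ≤ s ∧ 1 ≤ s ∧ colr s = 0 ∧ inner ℂ (b s) (V.symm (b 0)) ≠ 0 := by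
    intro k
    obtain ⟨s, hs1, hs2, hs3⟩ := hex (max k 1)
    exact ⟨s, le_trans (le_max_left _ _) hs1, le_trans (le_max_right _ _) hs1, hs2, hs3⟩
  choose s hs using hs'
  let R : ℕ → ℝ := fun k => 1 + k / ε k ^ 2 + k * M k + k * M k / ‖inner ℂ (b k) (V.symm (b 0))‖
    + k * M k / ‖inner ℂ (b (s k)) (V.symm (b 0))‖
  have p1 : ∀ k : ℕ, 0 ≤ k / ε k ^ 2 := fun k => by positivity
  have p2 : ∀ k : ℕ, 0 ≤ k * M k := fun k => mul_nonneg (by positivity) (hM k)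
  have p3 : ∀ k : ℕ, 0 ≤ k * M k / ‖inner ℂ (b k) (V.symm (b 0))‖ :=
    fun k => div_nonneg (p2 k) (norm_nonneg _)
  have p4 : ∀ k : ℕ, 0 ≤ k * M k / ‖inner ℂ (b (s k)) (V.symm (b 0))‖ :=
    fun k => div_nonneg (p2 k) (norm_nonneg _)
  have hR : ∀ k, 1 ≤ R k := fun k => by
    have := p1 k; have := p2 k; have := p3 k; have := p4 k
    simp only [R]; linarith
  have hR0 : ∀ k, k / ε k ^ 2 ≤ R k := fun k => by
    have := p1 k; have := p2 k; have := p3 k; have := p4 k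
    simp only [R]; linarith
  have hRε : ∀ k : ℕ, (k:ℝ) ≤ R k * ε k ^ 2 := fun k =>
    (div_le_iff₀ (pow_pos (hε0 k) 2)).mp (hR0 k)
  obtain ⟨T, g, P, hg0, hg, hT0, hTg, hPd, hT, hTm⟩ := aux_T b colr colr_lt R hR
  have hi : ∀ x : H, x ≠ 0 →
        Dense (Set.range fun n : ℕ => (T ^ n) x) ∨
        Dense (Set.range fun n : ℕ => (T ^ n) (V x)) := by
    intro x hx
    by_contra hcon
    push Not at hcon
    have key : ∀ y, ¬ Dense (Set.range fun n : ℕ => (T ^ n) y) → ∃ c, IsBad b colr ε c y := by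
      intro y hy
      by_contra hc
      push Not at hc
      exact hy (aux_hyp b colr R ε hR hε0 hε1 hRε T g P hg0 hg hTg hT y hc)
    obtain ⟨c, hc⟩ := key _ hcon.1
    obtain ⟨c', hc'⟩ := key _ hcon.2
    exact hx (hbad c c' x hc hc')
  refine ⟨T, V, hi, ?_⟩
  have hden : Dense (Set.range fun n : ℕ => (T ^ n) (V (b 0))) := by
    rcases hi (b 0) hb0 with hd | hd
    · exfalso
      have hr : (Set.range fun n : ℕ => (T ^ n) (b 0)) ⊆ {b 0} := by
        rintro _ ⟨n, rfl⟩
        show (T ^ n) (b 0) = b 0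
        induction n with
        | zero => simp
        | succ n ih => rw [pow_succ, ContinuousLinearMap.mul_apply, hT0, ih]
      have hd2 : Dense ({b 0} : Set H) := hd.mono hr
      have h0 : (0 : H) ∈ closure ({b 0} : Set H) := hd2 0
      rw [closure_singleton] at h0
      exact hb0 (by simpa using h0.symm)
    · exact hd
  intro K hK
  set T' : H →L[ℂ] H := (V.symm.toContinuousLinearEquiv : H →L[ℂ] H).comp
            (T.comp (V.toContinuousLinearEquiv : H →L[ℂ] H)) with hT'
  let A := (Algebra.adjoin ℂ {T, T'}).topologicalClosure
  have hA : IsClosed (A : Set (H →L[ℂ] H)) := Subalgebra.isClosed_topologicalClosure _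
  have hTA : T ∈ A := Subalgebra.le_topologicalClosure _ (Algebra.subset_adjoin (by simp))
  have hTA' : T' ∈ A := Subalgebra.le_topologicalClosure _ (Algebra.subset_adjoin (by simp))
  have hrk := aux_alg b T T' V R M h colr s hR hM hMm (fun x => rfl)
    (by
      intro k hk hc
      obtain ⟨m, hm⟩ := hTm k hk
      rw [hc, hg0] at hm
      exact ⟨m, hm⟩) hden hh hV hs
    (fun k => by
      have := p1 k; have := p2 k; have := p3 k; have := p4 k
      simp only [R]; linarith)
    (fun k _ => by
      have := p1 k; have := p2 k; have := p3 k; have := p4 k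
      simp only [R]; linarith)
    (fun k => by
      have := p1 k; have := p2 k; have := p3 k; have := p4 k
      simp only [R]; linarith) A hA hTA hTA'
  have := aux_compact b A hA hrk K hK
  rw [← Subalgebra.topologicalClosure_coe]
  exact this
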